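/- arXiv:2506.09667 — 4 statements merged into one kernel-verified Lean document; each statement's English description precedes it below -/
import Mathlib

section
/- For each integer k ≥ 2, the graph F_k contains no cycle of length 3ℓ for any integer ℓ with 1 ≤ ℓ ≤ k−1, and no cycle of length 3ℓ+1 for any integer ℓ with 2 ≤ ℓ ≤ k−1. -/
/-- A graph is hamiltonian-connected if any two distinct vertices are joined by a
hamiltonian path, i.e. a path visiting every vertex. -/
def SimpleGraph.HamiltonianConnected {V : Type*} (G : SimpleGraph V) : Prop :=
  ∀ u v : V, u ≠ v → ∃ p : G.Walk u v, p.IsPath ∧ ∀ w : V, w ∈ p.support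

/-- The graph `F_k` of the paper: `k` copies of the gadget `G_A` joined in a ring.
Vertex `(i, j)` represents the vertex `v_{i, j+1}` of the paper. -/
def Fgraph (k : ℕ) : SimpleGraph (ZMod k × Fin 6) :=
  SimpleGraph.fromEdgeSet
    (⋃ i : ZMod k,
      ({s((i, 0), (i, 1)), s((i, 1), (i, 2)), s((i, 3), (i, 4)), s((i, 4), (i, 5)),
        s((i, 0), (i, 4)), s((i, 1), (i, 3)), s((i, 2), (i, 5)),
        s((i, 2), (i + 1, 0)), s((i, 5), (i + 1, 3))} : Set (Sym2 (ZMod k × Fin 6))))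

/-- `m` records whether a cubic vertex lies on a 2-regular subgraph, and `x y z` which of its
three edges do. -/
def CubicLocal (m x y z : Bool) : Prop := m = (x || y || z) ∧ x = xor y z

instance (m x y z : Bool) : Decidable (CubicLocal m x y z) :=
  inferInstanceAs (Decidable (_ ∧ _))

set_option synthInstance.maxSize 100000 in
/-- The possible traces of a 2-regular subgraph on one copy of the gadget; `p q` are the links
entering the copy, `p' q'` the links leaving it. -/
theorem gadget_trace : ∀ p e01 e04 m0 : Bool, CubicLocal m0 e01 e04 p →
    ∀ e12 e13 m1 : Bool, CubicLocal m1 e01 e12 e13 →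
    ∀ p' e25 m2 : Bool, CubicLocal m2 e12 e25 p' →
    ∀ q e34 m3 : Bool, CubicLocal m3 e34 e13 q →
    ∀ e45 m4 : Bool, CubicLocal m4 e34 e45 e04 →
    ∀ q' m5 : Bool, CubicLocal m5 e45 e25 q' →
    (p = q ↔ p' = q') ∧
    (p ≠ q → 3 ≤ m0.toNat + m1.toNat + m2.toNat + m3.toNat + m4.toNat + m5.toNat) ∧
    (p = q → p' = q' → ∀ n, n = m0.toNat + m1.toNat + m2.toNat + m3.toNat + m4.toNat + m5.toNat →
      (p = false → p' = false → n = 0 ∨ n = 4 ∨ n = 5) ∧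
      (p = false → p' = true →
        n = 2 ∨ n = 5 ∨ n = 6 ∧ e12 = false ∧ e45 = false ∧ m0 = true ∧ m2 = true) ∧
      (p = true → p' = false → n = 3 ∨ n = 6) ∧
      (p = true → p' = true →
        n = 6 ∨ n = 5 ∧ e12 = false ∧ e45 = false ∧ m2 = true)) := by
  simp only [forall_eq]
  decide +kernel

theorem ZMod.forall_of_forall_add_one {k : ℕ} [NeZero k] {P : ZMod k → Prop}
    (h : ∀ a, P a → P (a + 1)) {a : ZMod k} (ha : P a) (b : ZMod k) : P b := by
  have key : ∀ n : ℕ, P (a + n) := by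
    intro n
    induction n with
    | zero => simpa using ha
    | succ n ih => simpa [add_assoc] using h _ ih
  simpa using key (b - a).val

theorem ZMod.natCast_inj_of_lt {k i j : ℕ} (hi : i < k) (hj : j < k)
    (h : (i : ZMod k) = j) : i = j := by
  rw [ZMod.natCast_eq_natCast_iff', Nat.mod_eq_of_lt hi, Nat.mod_eq_of_lt hj] at h
  exact h

theorem Fgraph_adj_cases {k : ℕ} {x y : ZMod k × Fin 6} (h : (Fgraph k).Adj x y) :
    ∃ a : ZMod k, ∃ u v : ZMod k × Fin 6, (x = u ∧ y = v ∨ x = v ∧ y = u) ∧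
      ((u = (a, 0) ∧ v = (a, 1)) ∨ (u = (a, 1) ∧ v = (a, 2)) ∨ (u = (a, 3) ∧ v = (a, 4)) ∨
      (u = (a, 4) ∧ v = (a, 5)) ∨ (u = (a, 0) ∧ v = (a, 4)) ∨ (u = (a, 1) ∧ v = (a, 3)) ∨
      (u = (a, 2) ∧ v = (a, 5)) ∨ (u = (a, 2) ∧ v = (a + 1, 0)) ∨
      (u = (a, 5) ∧ v = (a + 1, 3))) := by
  simp only [Fgraph, SimpleGraph.fromEdgeSet_adj, Set.mem_iUnion, Set.mem_insert_iff,
    Set.mem_singleton_iff] at h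
  obtain ⟨⟨a, h⟩, -⟩ := h
  refine ⟨a, ?_⟩
  rcases h with h | h | h | h | h | h | h | h | h <;>
  · rw [Sym2.eq_iff] at h
    exact ⟨_, _, h, by simp⟩

theorem Fgraph_neighbors {k : ℕ} (a : ZMod k) :
    (∀ w, (Fgraph k).Adj (a, 0) w → w = (a, 1) ∨ w = (a, 4) ∨ w = (a - 1, 2)) ∧
    (∀ w, (Fgraph k).Adj (a, 1) w → w = (a, 0) ∨ w = (a, 2) ∨ w = (a, 3)) ∧
    (∀ w, (Fgraph k).Adj (a, 2) w → w = (a, 1) ∨ w = (a, 5) ∨ w = (a + 1, 0)) ∧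
    (∀ w, (Fgraph k).Adj (a, 3) w → w = (a, 4) ∨ w = (a, 1) ∨ w = (a - 1, 5)) ∧
    (∀ w, (Fgraph k).Adj (a, 4) w → w = (a, 3) ∨ w = (a, 5) ∨ w = (a, 0)) ∧
    (∀ w, (Fgraph k).Adj (a, 5) w → w = (a, 4) ∨ w = (a, 2) ∨ w = (a + 1, 3)) := by
  refine ⟨?_, ?_, ?_, ?_, ?_, ?_⟩ <;>
  · intro w hw
    obtain ⟨b, u, v, ⟨h1, rfl⟩ | ⟨h1, rfl⟩, h⟩ := Fgraph_adj_cases hw <;> clear hw <;>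
      rcases h with ⟨rfl, rfl⟩ | ⟨rfl, rfl⟩ | ⟨rfl, rfl⟩ | ⟨rfl, rfl⟩ | ⟨rfl, rfl⟩ | ⟨rfl, rfl⟩ |
        ⟨rfl, rfl⟩ | ⟨rfl, rfl⟩ | ⟨rfl, rfl⟩ <;>
      obtain ⟨rfl, h2⟩ := Prod.mk.inj h1 <;>
      first | exact absurd h2 (by decide) | simp

/-- The combinatorial shadow of a cycle of `Fgraph k`: its vertices `mem`, its edges `adj`. -/
structure FgraphCycle (k : ℕ) where
  mem : ZMod k × Fin 6 → Prop
  adj : ZMod k × Fin 6 → ZMod k × Fin 6 → Prop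
  symm : ∀ {x y}, adj x y → adj y x
  le : ∀ {x y}, adj x y → (Fgraph k).Adj x y
  mem_of_adj : ∀ {x y}, adj x y → mem x
  two : ∀ {x}, mem x → ∃ y z, y ≠ z ∧ ∀ w, adj x w ↔ w = y ∨ w = z
  nonempty : ∃ x, mem x
  conn : ∀ S : ZMod k × Fin 6 → Prop, (∀ x y, adj x y → S x → S y) →
    ∀ x, mem x → S x → ∀ y, mem y → S y

namespace FgraphCycle

variable {k : ℕ} (C : FgraphCycle k)

open Classical in
/-- The number of vertices of the cycle in copy `a`. -/
noncomputable def count (a : ZMod k) : ℕ := ∑ j : Fin 6, (decide (C.mem (a, j))).toNat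

/-- The upper link entering copy `a` is used. -/
def top (a : ZMod k) : Prop := C.adj (a - 1, 2) (a, 0)

/-- The lower link entering copy `a` is used. -/
def bot (a : ZMod k) : Prop := C.adj (a - 1, 5) (a, 3)

theorem adj_comm {x y : ZMod k × Fin 6} : C.adj x y ↔ C.adj y x := ⟨C.symm, C.symm⟩

open Classical in
theorem cubicLocal {x p q r : ZMod k × Fin 6} (hpq : p ≠ q) (hpr : p ≠ r) (hqr : q ≠ r)
    (h : ∀ w, (Fgraph k).Adj x w → w = p ∨ w = q ∨ w = r) :
    CubicLocal (decide (C.mem x)) (decide (C.adj x p)) (decide (C.adj x q))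
      (decide (C.adj x r)) := by
  by_cases hx : C.mem x
  · obtain ⟨y, z, hyz, hw⟩ := C.two hx
    have hy := h y (C.le ((hw y).2 (Or.inl rfl)))
    have hz := h z (C.le ((hw z).2 (Or.inr rfl)))
    simp only [hw, hx, CubicLocal]
    rcases hy with rfl | rfl | rfl <;> rcases hz with rfl | rfl | rfl <;>
      simp_all [eq_comm]
  · have hn : ∀ w, ¬ C.adj x w := fun w hw => hx (C.mem_of_adj hw)
    simp [CubicLocal, hn, hx]

open Classical in
theorem trace (a : ZMod k) :
    ((C.top a ↔ C.bot a) ↔ (C.top (a + 1) ↔ C.bot (a + 1))) ∧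
    (¬ (C.top a ↔ C.bot a) → 3 ≤ C.count a) ∧
    ((C.top a ↔ C.bot a) → (C.top (a + 1) ↔ C.bot (a + 1)) →
      (¬ C.top a → ¬ C.top (a + 1) → C.count a = 0 ∨ C.count a = 4 ∨ C.count a = 5) ∧
      (¬ C.top a → C.top (a + 1) → C.count a = 2 ∨ C.count a = 5 ∨ C.count a = 6 ∧
        ¬ C.adj (a, 1) (a, 2) ∧ ¬ C.adj (a, 4) (a, 5) ∧ C.mem (a, 0) ∧ C.mem (a, 2)) ∧
      (C.top a → ¬ C.top (a + 1) → C.count a = 3 ∨ C.count a = 6) ∧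
      (C.top a → C.top (a + 1) → C.count a = 6 ∨ C.count a = 5 ∧
        ¬ C.adj (a, 1) (a, 2) ∧ ¬ C.adj (a, 4) (a, 5) ∧ C.mem (a, 2))) := by
  have h0 := C.cubicLocal (x := (a, 0)) (p := (a, 1)) (q := (a, 4)) (r := (a - 1, 2))
    (by simp) (by simp) (by simp) (Fgraph_neighbors a).1
  have h1 := C.cubicLocal (x := (a, 1)) (p := (a, 0)) (q := (a, 2)) (r := (a, 3))
    (by simp) (by simp) (by simp) (Fgraph_neighbors a).2.1
  have h2 := C.cubicLocal (x := (a, 2)) (p := (a, 1)) (q := (a, 5)) (r := (a + 1, 0))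
    (by simp) (by simp) (by simp) (Fgraph_neighbors a).2.2.1
  have h3 := C.cubicLocal (x := (a, 3)) (p := (a, 4)) (q := (a, 1)) (r := (a - 1, 5))
    (by simp) (by simp) (by simp) (Fgraph_neighbors a).2.2.2.1
  have h4 := C.cubicLocal (x := (a, 4)) (p := (a, 3)) (q := (a, 5)) (r := (a, 0))
    (by simp) (by simp) (by simp) (Fgraph_neighbors a).2.2.2.2.1
  have h5 := C.cubicLocal (x := (a, 5)) (p := (a, 4)) (q := (a, 2)) (r := (a + 1, 3))
    (by simp) (by simp) (by simp) (Fgraph_neighbors a).2.2.2.2.2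
  rw [C.adj_comm (x := (a, 0)) (y := (a - 1, 2))] at h0
  rw [C.adj_comm (x := (a, 1)) (y := (a, 0))] at h1
  rw [C.adj_comm (x := (a, 2)) (y := (a, 1))] at h2
  rw [C.adj_comm (x := (a, 3)) (y := (a, 1)), C.adj_comm (x := (a, 3)) (y := (a - 1, 5))] at h3
  rw [C.adj_comm (x := (a, 4)) (y := (a, 3)), C.adj_comm (x := (a, 4)) (y := (a, 0))] at h4
  rw [C.adj_comm (x := (a, 5)) (y := (a, 4)), C.adj_comm (x := (a, 5)) (y := (a, 2))] at h5
  have h := gadget_trace _ _ _ _ h0 _ _ _ h1 _ _ _ h2 _ _ _ h3 _ _ h4 _ _ h5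
  obtain ⟨ha, hb, hc⟩ := h
  have hcount : C.count a = _ := Fin.sum_univ_six _
  refine ⟨?_, ?_, ?_⟩
  · simpa [top, bot] using ha
  · intro h
    rw [hcount]
    exact hb (by simpa [top, bot] using h)
  · intro h h'
    have := hc (by simpa [top, bot] using h) (by simpa [top, bot] using h') _ hcount
    simpa [top, bot] using this

/-- Whether a vertex of the gadget survives on its left side after cutting `12` and `45`. -/
def IsLeft (j : Fin 6) : Prop := j ≠ 2 ∧ j ≠ 5

theorem adj_cases {x y : ZMod k × Fin 6} (h : C.adj x y) :
    (y.1 = x.1 ∧ (IsLeft x.2 → IsLeft y.2 ∨ C.adj (x.1, 1) (x.1, 2) ∨ C.adj (x.1, 4) (x.1, 5))) ∨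
    (y.1 = x.1 + 1 ∧ ¬ IsLeft x.2 ∧ IsLeft y.2 ∧ (C.top (x.1 + 1) ∨ C.bot (x.1 + 1))) ∨
    (x.1 = y.1 + 1 ∧ ¬ IsLeft y.2 ∧ (C.top x.1 ∨ C.bot x.1)) := by
  obtain ⟨a, u, v, huv, hc⟩ := Fgraph_adj_cases (C.le h)
  have h' := C.symm h
  rcases huv with ⟨rfl, rfl⟩ | ⟨rfl, rfl⟩ <;>
    rcases hc with ⟨rfl, rfl⟩ | ⟨rfl, rfl⟩ | ⟨rfl, rfl⟩ | ⟨rfl, rfl⟩ | ⟨rfl, rfl⟩ | ⟨rfl, rfl⟩ |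
      ⟨rfl, rfl⟩ | ⟨rfl, rfl⟩ | ⟨rfl, rfl⟩ <;>
    simp [IsLeft, top, bot, h, h']

theorem count_eq_zero {a : ZMod k} (h : ∀ j, ¬ C.mem (a, j)) : C.count a = 0 := by
  simp [count, h]

theorem count_ne_zero {a : ZMod k} {j : Fin 6} (h : C.mem (a, j)) : C.count a ≠ 0 := by
  intro h0
  have := (Finset.sum_eq_zero_iff.1 h0) j (Finset.mem_univ _)
  simp [h] at this

theorem sum_count_of_segment [NeZero k] (a : ZMod k) {m : ℕ} (hm : m < k)
    (h : ∀ x, C.mem x → ∃ j ≤ m, x.1 = a + (j : ℕ)) :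
    ∑ b, C.count b = ∑ j ∈ Finset.range (m + 1), C.count (a + (j : ℕ)) := by
  classical
  rw [← Finset.sum_image (s := Finset.range (m + 1)) (g := fun j : ℕ => a + (j : ZMod k))
    (f := C.count)]
  · symm
    apply Finset.sum_subset (Finset.subset_univ _)
    intro b _ hb
    refine C.count_eq_zero fun j hj => hb ?_
    obtain ⟨i, hi, hij⟩ := h _ hj
    exact Finset.mem_image.2 ⟨i, Finset.mem_range.2 (by omega), hij.symm⟩
  · intro i hi j hj hij
    simp only [Finset.coe_range, Set.mem_Iio] at hi hj
    exact ZMod.natCast_inj_of_lt (by omega) (by omega) (add_left_cancel hij)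

theorem count_of_start (hE : ∀ b, C.top b ↔ C.bot b) {a : ZMod k}
    (ha : ¬ C.top a) (ha' : C.top (a + 1)) : C.count a = 2 ∨ C.count a = 5 := by
  obtain h | h | ⟨-, h12, h45, h0, h2⟩ := (C.trace a).2.2 (hE _) (hE _) |>.2.1 ha ha'
  · exact Or.inl h
  · exact Or.inr h
  · exfalso
    refine (C.conn (fun x => x.1 = a ∧ IsLeft x.2) ?_ _ h0 ⟨rfl, by simp [IsLeft]⟩ _ h2).2.1 rfl
    rintro x y hxy ⟨rfl, hl⟩
    rcases C.adj_cases hxy with ⟨h1, h⟩ | ⟨-, h, -⟩ | ⟨-, -, h⟩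
    · exact ⟨h1, by simpa [h12, h45] using h hl⟩
    · exact absurd hl h
    · simp [← hE, ha] at h

/-- A cycle starting (on its left) in copy `a`, and not winding around the ring. -/
theorem sum_count_mod_three [NeZero k] (hE : ∀ b, C.top b ↔ C.bot b) {a : ZMod k}
    (ha : ¬ C.top a) (ha' : C.top (a + 1)) : (∑ b, C.count b) % 3 = 2 := by
  have hk0 := NeZero.ne k
  have hk : k ≠ 1 := by
    rintro rfl
    rw [Subsingleton.elim (a + 1) a] at ha'
    exact ha ha'
  have hlast : a + ((k - 1 : ℕ) : ZMod k) + 1 = a := by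
    have : ((k - 1 : ℕ) : ZMod k) + 1 = ((k - 1 + 1 : ℕ) : ZMod k) := by push_cast; rfl
    rw [add_assoc, this, Nat.sub_add_cancel (by omega)]
    simp
  have hex : ∃ m : ℕ, 1 ≤ m ∧
      ¬ (C.top (a + (m : ℕ) + 1) ∧ C.count (a + (m : ℕ)) = 6) :=
    ⟨k - 1, by omega, by rw [hlast]; simp [ha]⟩
  classical
  obtain ⟨m, ⟨hm1, hm⟩, hmin⟩ : ∃ m, (1 ≤ m ∧
      ¬ (C.top (a + (m : ℕ) + 1) ∧ C.count (a + (m : ℕ)) = 6)) ∧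
      ∀ j < m, 1 ≤ j → C.top (a + (j : ℕ) + 1) ∧ C.count (a + (j : ℕ)) = 6 := by
    refine ⟨Nat.find hex, Nat.find_spec hex, fun j hj hj1 => ?_⟩
    by_contra hn
    exact Nat.find_min hex hj ⟨hj1, hn⟩
  have hmk : m < k := by
    by_contra hn
    have := (hmin (k - 1) (by omega) (by omega)).1
    rw [hlast] at this
    exact ha this
  have htop : C.top (a + (m : ℕ)) := by
    obtain rfl | h1 := Nat.eq_or_lt_of_le hm1
    · simpa using ha'
    · have := (hmin (m - 1) (by omega) (by omega)).1
      rwa [add_assoc, ← Nat.cast_add_one, Nat.sub_add_cancel hm1] at this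
  have hmem0 : ∃ j, C.mem (a, j) := by
    have h0 := C.count_of_start hE ha ha'
    by_contra! hn
    have := C.count_eq_zero hn
    omega
  have hprefix : ∀ t < m, (∑ j ∈ Finset.range (t + 1), C.count (a + (j : ℕ))) % 3 = 2 := by
    intro t
    induction t with
    | zero =>
      intro _
      have h0 := C.count_of_start hE ha ha'
      simp only [zero_add, Finset.sum_range_one, Nat.cast_zero, add_zero]
      omega
    | succ t ih =>
      intro ht
      rw [Finset.sum_range_succ, (hmin (t + 1) ht (by omega)).2]
      have := ih (by omega)
      omega
  obtain ⟨j0, hj0⟩ := hmem0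
  by_cases hnext : C.top (a + (m : ℕ) + 1)
  · exfalso
    obtain h6 | ⟨-, h12, h45, hmem2⟩ := (C.trace (a + (m : ℕ))).2.2 (hE _) (hE _) |>.2.2.2 htop hnext
    · exact hm ⟨hnext, h6⟩
    obtain ⟨j, hj, hja, hjl⟩ := C.conn
      (fun x => ∃ j ≤ m, x.1 = a + (j : ℕ) ∧ (j = m → IsLeft x.2)) (by
        rintro x y hxy ⟨j, hj, hx, hl⟩
        rcases C.adj_cases hxy with ⟨h1, h2⟩ | ⟨h1, h2, h3, h4⟩ | ⟨h1, h2, h3⟩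
        · refine ⟨j, hj, h1.trans hx, ?_⟩
          rintro rfl
          rw [hx] at h2
          simpa [h12, h45] using h2 (hl rfl)
        · have : j ≠ m := fun h => h2 (hl h)
          exact ⟨j + 1, by omega, by rw [h1, hx]; push_cast; ring, fun _ => h3⟩
        · rw [← hE, or_self] at h3
          have hj0 : j ≠ 0 := by
            rintro rfl
            rw [hx] at h3
            simp [ha] at h3
          refine ⟨j - 1, by omega, ?_, fun h => by omega⟩
          rw [hx] at h1
          rw [Nat.cast_pred (by omega), ← add_sub_assoc, h1, add_sub_cancel_right])
      _ hj0 ⟨0, by omega, by simp, by omega⟩ _ hmem2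
    have := ZMod.natCast_inj_of_lt hmk (by omega) (add_left_cancel hja)
    exact (hjl this.symm).1 rfl
  · have hend := (C.trace (a + (m : ℕ))).2.2 (hE _) (hE _) |>.2.2.1 htop hnext
    rw [C.sum_count_of_segment a hmk, Finset.sum_range_succ]
    · have := hprefix (m - 1) (by omega)
      rw [Nat.sub_add_cancel hm1] at this
      omega
    · refine C.conn (fun x => ∃ j ≤ m, x.1 = a + (j : ℕ)) ?_ _ hj0 ⟨0, by omega, by simp⟩
      rintro x y hxy ⟨j, hj, hx⟩
      rcases C.adj_cases hxy with ⟨h1, h2⟩ | ⟨h1, h2, h3, h4⟩ | ⟨h1, h2, h3⟩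
      · exact ⟨j, hj, h1.trans hx⟩
      · rw [← hE, or_self] at h4
        have : j ≠ m := by
          rintro rfl
          rw [hx] at h4
          exact hnext h4
        exact ⟨j + 1, by omega, by rw [h1, hx]; push_cast; ring⟩
      · rw [← hE, or_self] at h3
        have hj0 : j ≠ 0 := by
          rintro rfl
          rw [hx] at h3
          simp [ha] at h3
        refine ⟨j - 1, by omega, ?_⟩
        rw [hx] at h1
        rw [Nat.cast_pred (by omega), ← add_sub_assoc, h1, add_sub_cancel_right]

theorem sum_count_cases [NeZero k] :
    3 * k - 1 ≤ ∑ b, C.count b ∨ ∑ b, C.count b = 4 ∨ (∑ b, C.count b) % 3 = 2 := by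
  have hsum : ∀ c : ℕ, (∀ b, c ≤ C.count b) → c * k ≤ ∑ b, C.count b := by
    intro c hc
    have := Finset.card_nsmul_le_sum Finset.univ C.count c fun b _ => hc b
    simpa [ZMod.card, mul_comm] using this
  by_cases hE : ∀ b, C.top b ↔ C.bot b
  · by_cases hall : ∀ b, C.top b
    · left
      have := hsum 5 fun b => by
        have := (C.trace b).2.2 (hE _) (hE _) |>.2.2.2 (hall _) (hall _)
        omega
      omega
    · right
      push Not at hall
      obtain ⟨i, hi⟩ := hall
      by_cases hstart : ∃ a, ¬ C.top a ∧ C.top (a + 1)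
      · obtain ⟨a, ha, ha'⟩ := hstart
        exact Or.inr (C.sum_count_mod_three hE ha ha')
      · push Not at hstart
        have hno := ZMod.forall_of_forall_add_one hstart hi
        obtain ⟨⟨a, j⟩, hx⟩ := C.nonempty
        have hcount := (C.trace a).2.2 (hE _) (hE _) |>.1 (hno _) (hno _)
        have hne := C.count_ne_zero hx
        rw [C.sum_count_of_segment a (m := 0) (NeZero.pos k)]
        · simp only [zero_add, Finset.sum_range_one, Nat.cast_zero, add_zero]
          omega
        · refine C.conn _ ?_ _ hx ⟨0, le_rfl, by simp⟩
          rintro x y hxy ⟨j, hj, hx⟩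
          rcases C.adj_cases hxy with ⟨h1, -⟩ | ⟨-, -, -, h⟩ | ⟨-, -, h⟩
          · exact ⟨j, hj, h1.trans hx⟩
          · simp [← hE, hno] at h
          · simp [← hE, hno] at h
  · left
    obtain ⟨i, hi⟩ := not_forall.1 hE
    have hodd := ZMod.forall_of_forall_add_one (P := fun b => ¬ (C.top b ↔ C.bot b))
      (fun b => (not_congr (C.trace b).1).1) hi
    have := hsum 3 fun b => (C.trace b).2.1 (hodd b)
    omega

/-- The data of a cycle given as a walk. -/
def ofWalk {u : ZMod k × Fin 6} (c : (Fgraph k).Walk u u) (hc : c.IsCycle) : FgraphCycle k where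
  mem x := x ∈ c.support
  adj := c.toSubgraph.Adj
  symm h := h.symm
  le h := h.adj_sub
  mem_of_adj h := c.mem_verts_toSubgraph.1 (c.toSubgraph.edge_vert h)
  two {x} hx := by
    obtain ⟨y, z, hyz, h⟩ := Set.ncard_eq_two.1 (hc.ncard_neighborSet_toSubgraph_eq_two hx)
    refine ⟨y, z, hyz, fun w => ?_⟩
    rw [← SimpleGraph.Subgraph.mem_neighborSet, h]
    simp
  nonempty := ⟨u, c.start_mem_support⟩
  conn S hS x hx hSx y hy := by
    rw [← c.mem_verts_toSubgraph] at hx hy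
    obtain ⟨p⟩ := c.toSubgraph_connected.preconnected ⟨x, hx⟩ ⟨y, hy⟩
    have key : ∀ {v w : c.toSubgraph.verts}, c.toSubgraph.coe.Walk v w → S v → S w := by
      intro v w p
      induction p with
      | nil => exact id
      | cons h _ ih => exact fun hv => ih (hS _ _ h hv)
    exact key p hSx

theorem sum_count_ofWalk [NeZero k] {u : ZMod k × Fin 6} (c : (Fgraph k).Walk u u)
    (hc : c.IsCycle) : ∑ b, (ofWalk c hc).count b = c.length := by
  classical
  have hcard : c.support.tail.toFinset.card = c.length := by
    rw [List.toFinset_card_of_nodup hc.support_nodup]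
    simp
  have hmem : ∀ x, x ∈ c.support ↔ x ∈ c.support.tail := fun x =>
    ⟨fun h => by
      rw [SimpleGraph.Walk.mem_support_iff] at h
      rcases h with rfl | h
      · exact SimpleGraph.Walk.end_mem_tail_support hc.not_nil
      · exact h, List.mem_of_mem_tail⟩
  have hfilter : c.support.tail.toFinset = Finset.univ.filter (· ∈ c.support) := by
    ext x
    simp [hmem]
  have hsum : ∑ b, (ofWalk c hc).count b =
      ∑ x : ZMod k × Fin 6, (decide (x ∈ c.support)).toNat := by
    rw [Fintype.sum_prod_type]
    simp only [count, ofWalk]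
    congr!
    exact decide_eq_decide.2 Iff.rfl
  rw [hsum, ← hcard, hfilter, Finset.card_filter]
  refine Finset.sum_congr rfl fun x _ => ?_
  by_cases hx : x ∈ c.support <;> simp [hx]

end FgraphCycle

/-- `F_k` has no cycle of length `3ℓ` for `1 ≤ ℓ ≤ k - 1` and no cycle of length
`3ℓ + 1` for `2 ≤ ℓ ≤ k - 1`. -/
theorem Fgraph_missing_cycle_lengths (k : ℕ) (hk : 2 ≤ k) :
    (∀ ℓ : ℕ, 1 ≤ ℓ → ℓ ≤ k - 1 →
      ¬ ∃ (u : ZMod k × Fin 6) (c : (Fgraph k).Walk u u), c.IsCycle ∧ c.length = 3 * ℓ) ∧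
    (∀ ℓ : ℕ, 2 ≤ ℓ → ℓ ≤ k - 1 →
      ¬ ∃ (u : ZMod k × Fin 6) (c : (Fgraph k).Walk u u), c.IsCycle ∧ c.length = 3 * ℓ + 1) := by
  have : NeZero k := ⟨by omega⟩
  have key : ∀ (u : ZMod k × Fin 6) (c : (Fgraph k).Walk u u), c.IsCycle →
      3 * k - 1 ≤ c.length ∨ c.length = 4 ∨ c.length % 3 = 2 := fun u c hc => by
    rw [← FgraphCycle.sum_count_ofWalk c hc]
    exact FgraphCycle.sum_count_cases _
  constructor
  · rintro ℓ h1 h2 ⟨u, c, hc, hl⟩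
    have := key u c hc
    omega
  · rintro ℓ h1 h2 ⟨u, c, hc, hl⟩
    have := key u c hc
    omega
end

section
/- For each integer k ≥ 2, the graph F_k contains a cycle of length ℓ for every ℓ in the set {4} ∪ {3m+2 : 1 ≤ m ≤ k−1} ∪ {ℓ : 3k ≤ ℓ ≤ 6k}. -/
namespace Fgraph

open SimpleGraph

variable {k : ℕ}

lemma adj_of_mem {u v : ZMod k × Fin 6} (i : ZMod k) (hne : u ≠ v)
    (h : s(u, v) ∈ ({s((i, 0), (i, 1)), s((i, 1), (i, 2)), s((i, 3), (i, 4)), s((i, 4), (i, 5)),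
        s((i, 0), (i, 4)), s((i, 1), (i, 3)), s((i, 2), (i, 5)),
        s((i, 2), (i + 1, 0)), s((i, 5), (i + 1, 3))} : Set (Sym2 (ZMod k × Fin 6)))) :
    (Fgraph k).Adj u v := by
  rw [Fgraph, fromEdgeSet_adj]
  exact ⟨Set.mem_iUnion.mpr ⟨i, h⟩, hne⟩

lemma adj01 (i : ZMod k) : (Fgraph k).Adj (i, 0) (i, 1) := adj_of_mem i (by simp) (by simp)
lemma adj12 (i : ZMod k) : (Fgraph k).Adj (i, 1) (i, 2) := adj_of_mem i (by simp) (by simp)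
lemma adj34 (i : ZMod k) : (Fgraph k).Adj (i, 3) (i, 4) := adj_of_mem i (by simp) (by simp)
lemma adj45 (i : ZMod k) : (Fgraph k).Adj (i, 4) (i, 5) := adj_of_mem i (by simp) (by simp)
lemma adj04 (i : ZMod k) : (Fgraph k).Adj (i, 0) (i, 4) := adj_of_mem i (by simp) (by simp)
lemma adj13 (i : ZMod k) : (Fgraph k).Adj (i, 1) (i, 3) := adj_of_mem i (by simp) (by simp)
lemma adj25 (i : ZMod k) : (Fgraph k).Adj (i, 2) (i, 5) := adj_of_mem i (by simp) (by simp)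

lemma adj20 (i : ZMod k) : (Fgraph k).Adj (i, 2) (i + 1, 0) :=
  adj_of_mem i (by simp) (by simp)

lemma adj53 (i : ZMod k) : (Fgraph k).Adj (i, 5) (i + 1, 3) :=
  adj_of_mem i (by simp) (by simp)

/-- `w` lies in one of the copies `i + 1, …, k - 1`. -/
def After (i : ℕ) (w : ZMod k × Fin 6) : Prop := ∃ j : ℕ, i < j ∧ j < k ∧ w.1 = (j : ZMod k)

lemma After.mono {i j : ℕ} (hij : i ≤ j) {w : ZMod k × Fin 6} (h : After j w) : After i w := by
  obtain ⟨l, h1, h2, h3⟩ := h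
  exact ⟨l, by omega, h2, h3⟩

lemma after_succ {i : ℕ} (hi : i + 1 < k) (x : Fin 6) :
    After i (((i + 1 : ℕ) : ZMod k), x) := ⟨i + 1, by omega, hi, rfl⟩

lemma not_after (i : ℕ) (x : Fin 6) : ¬ After i ((i : ZMod k), x) := by
  rintro ⟨j, h1, h2, h3⟩
  have h := (ZMod.natCast_eq_natCast_iff' i j k).mp h3
  rw [Nat.mod_eq_of_lt h2, Nat.mod_eq_of_lt (by omega)] at h
  omega

/-- A path of length at least two whose ends are adjacent closes up to a cycle. -/
lemma exists_isCycle_of_isPath {V : Type*} {G : SimpleGraph V} {u v : V} {p : G.Walk u v}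
    {n : ℕ} (hp : p.IsPath) (hn : p.length = n) (h2 : 2 ≤ n) (h : G.Adj v u) :
    ∃ (x : V) (c : G.Walk x x), c.IsCycle ∧ c.length = n + 1 := by
  refine ⟨v, .cons h p, (Walk.cons_isCycle_iff p h).mpr ⟨hp, fun he => ?_⟩, by simp [hn]⟩
  have := hp.length_eq_one_of_mem_edges (Sym2.eq_swap ▸ he)
  omega

/-- A path leaving copy `i` from `(i, 2)` extends backwards through copy `i` to `(i, 0)`, using
`2`, `3`, `4` or `5` further vertices. -/
lemma exists_path_through {i n s : ℕ} {v : ZMod k × Fin 6}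
    (hs : 2 ≤ s ∧ s ≤ 5) (p : (Fgraph k).Walk ((i : ZMod k), 2) v) (hp : p.IsPath)
    (hn : p.length = n) (hsup : ∀ w ∈ p.support, w = ((i : ZMod k), 2) ∨ After i w) :
    ∃ q : (Fgraph k).Walk ((i : ZMod k), 0) v, q.IsPath ∧ q.length = n + s ∧
      ∀ w ∈ q.support, w.1 = (i : ZMod k) ∨ After i w := by
  have hsup' : ∀ w ∈ p.support, w.1 = (i : ZMod k) ∨ After i w := fun w hw =>
    (hsup w hw).imp (fun h => by rw [h]) id
  have fresh : ∀ x : Fin 6, x ≠ 2 → ((i : ZMod k), x) ∉ p.support := fun x hx hw =>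
    (hsup _ hw).elim (fun h => hx (Prod.ext_iff.mp h).2) (not_after i x)
  have f0 := fresh 0 (by decide)
  have f1 := fresh 1 (by decide)
  have f3 := fresh 3 (by decide)
  have f4 := fresh 4 (by decide)
  have f5 := fresh 5 (by decide)
  obtain rfl | rfl | rfl | rfl : s = 2 ∨ s = 3 ∨ s = 4 ∨ s = 5 := by omega
  · refine ⟨.cons (adj01 _) (.cons (adj12 _) p),
      by simp [Walk.cons_isPath_iff, *], by simp [*], by simpa using hsup'⟩
  · refine ⟨.cons (adj04 _) (.cons (adj45 _) (.cons (adj25 _).symm p)),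
      by simp [Walk.cons_isPath_iff, *], by simp [*], by simpa using hsup'⟩
  · refine ⟨.cons (adj04 _) (.cons (adj34 _).symm (.cons (adj13 _).symm (.cons (adj12 _) p))),
      by simp [Walk.cons_isPath_iff, *], by simp [*], by simpa using hsup'⟩
  · refine ⟨.cons (adj01 _) (.cons (adj13 _) (.cons (adj34 _) (.cons (adj45 _)
      (.cons (adj25 _).symm p)))),
      by simp [Walk.cons_isPath_iff, *], by simp [*], by simpa using hsup'⟩

lemma exists_path_top (t : ℕ) : ∀ i n : ℕ, i + t + 1 = k → 3 * t ≤ n → n ≤ 6 * t →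
    ∃ p : (Fgraph k).Walk ((i : ZMod k), 2) (((k - 1 : ℕ) : ZMod k), 2), p.IsPath ∧
      p.length = n ∧ ∀ w ∈ p.support, w = ((i : ZMod k), 2) ∨ After i w := by
  induction t with
  | zero =>
    intro i n hi h1 h2
    obtain rfl : i = k - 1 := by omega
    exact ⟨.nil, by simp, by simp; omega, by simp⟩
  | succ t ih =>
    intro i n hi h1 h2
    obtain ⟨s, m, hs, hm1, hm2, rfl⟩ : ∃ s m, (2 ≤ s ∧ s ≤ 5) ∧ 3 * t ≤ m ∧ m ≤ 6 * t ∧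
        n = m + s + 1 := by
      by_cases h : n ≤ 3 * t + 6
      · exact ⟨n - 1 - 3 * t, 3 * t, by omega, by omega, by omega, by omega⟩
      · exact ⟨5, n - 6, by omega, by omega, by omega, by omega⟩
    obtain ⟨p, hp, hl, hsup⟩ := ih (i + 1) m (by omega) hm1 hm2
    obtain ⟨q, hq, hql, hqs⟩ := exists_path_through hs p hp hl hsup
    have hqs' : ∀ w ∈ q.support, After i w := fun w hw =>
      (hqs w hw).elim (fun h => ⟨i + 1, by omega, by omega, h⟩) (After.mono (by omega))
    have ha : (Fgraph k).Adj ((i : ZMod k), 2) (((i + 1 : ℕ) : ZMod k), 0) := by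
      simpa using adj20 (i : ZMod k)
    refine ⟨.cons ha q, hq.cons fun h => not_after i 2 (hqs' _ h), by simp [hql], ?_⟩
    intro w hw
    rw [Walk.support_cons, List.mem_cons] at hw
    exact hw.imp id (hqs' w)

/-- A path entering copy `i + 1` at `(i + 1, 0)` and returning to `(i + 1, 3)`, after turning
around in copy `i + 1 + t`. -/
lemma exists_path_return (t : ℕ) : ∀ i n : ℕ, i + t + 1 < k → (n = 6 * t + 2 ∨ n = 6 * t + 5) →
    ∃ p : (Fgraph k).Walk (((i + 1 : ℕ) : ZMod k), 0) (((i + 1 : ℕ) : ZMod k), 3),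
      p.IsPath ∧ p.length = n ∧ ∀ w ∈ p.support, After i w := by
  induction t with
  | zero =>
    intro i n hi hn
    have ha := after_succ (show i + 1 < k by omega)
    obtain rfl | rfl := hn
    · refine ⟨.cons (adj01 _) (.cons (adj13 _) .nil), ?_, by simp, ?_⟩
      · simp
      · simp only [Walk.support_cons, Walk.support_nil, List.forall_mem_cons, ha, true_and]
        simp
    · refine ⟨.cons (adj01 _) (.cons (adj12 _) (.cons (adj25 _) (.cons (adj45 _).symm
        (.cons (adj34 _).symm .nil)))), ?_, by simp, ?_⟩
      · simp
      · simp only [Walk.support_cons, Walk.support_nil, List.forall_mem_cons, ha, true_and]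
        simp
  | succ t ih =>
    intro i n hi hn
    have ha := after_succ (show i + 1 < k by omega)
    obtain ⟨p, hp, hl, hsup⟩ := ih (i + 1) (n - 6) (by omega) (by omega)
    have fresh : ∀ x : Fin 6, (((i + 1 : ℕ) : ZMod k), x) ∉ p.support := fun x hx =>
      not_after (i + 1) x (hsup _ hx)
    have h20 : (Fgraph k).Adj (((i + 1 : ℕ) : ZMod k), 2) (((i + 1 + 1 : ℕ) : ZMod k), 0) := by
      simpa using adj20 ((i + 1 : ℕ) : ZMod k)
    have h53 : (Fgraph k).Adj (((i + 1 : ℕ) : ZMod k), 5) (((i + 1 + 1 : ℕ) : ZMod k), 3) := by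
      simpa using adj53 ((i + 1 : ℕ) : ZMod k)
    generalize ((i + 1 : ℕ) : ZMod k) = a at *
    refine ⟨.cons (adj01 _) (.cons (adj12 _) (.cons h20
      (((p.concat h53.symm).concat (adj45 _).symm).concat (adj34 _).symm))), ?_, ?_, ?_⟩
    · simp [Walk.cons_isPath_iff, Walk.concat_isPath_iff, Walk.support_concat, hp, fresh]
    · simp [hl]
      omega
    · intro w hw
      simp only [Walk.support_cons, Walk.support_concat, List.mem_cons, List.mem_append,
        List.not_mem_nil, or_false] at hw
      rcases hw with rfl | rfl | rfl | ((h | rfl) | rfl) | rfl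
      all_goals first | exact ha _ | exact (hsup _ h).mono (by omega)

lemma exists_cycle_four :
    ∃ (u : ZMod k × Fin 6) (c : (Fgraph k).Walk u u), c.IsCycle ∧ c.length = 4 :=
  exists_isCycle_of_isPath (n := 3)
    (p := .cons (adj01 0) (.cons (adj13 0) (.cons (adj34 0) .nil)))
    (by simp) rfl (by simp) (adj04 0).symm

lemma exists_cycle_local {t n : ℕ} (ht : t + 2 ≤ k) (hn : n = 6 * t + 5 ∨ n = 6 * t + 8) :
    ∃ (u : ZMod k × Fin 6) (c : (Fgraph k).Walk u u), c.IsCycle ∧ c.length = n := by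
  obtain ⟨p, hp, hl, hsup⟩ := exists_path_return (k := k) t 0 (n - 3) (by omega) (by omega)
  have h20 : (Fgraph k).Adj (((0 : ℕ) : ZMod k), 2) (((0 + 1 : ℕ) : ZMod k), 0) := by
    simpa using adj20 ((0 : ℕ) : ZMod k)
  have h53 : (Fgraph k).Adj (((0 : ℕ) : ZMod k), 5) (((0 + 1 : ℕ) : ZMod k), 3) := by
    simpa using adj53 ((0 : ℕ) : ZMod k)
  have fresh : ∀ x : Fin 6, (((0 : ℕ) : ZMod k), x) ∉ p.support := fun x hx =>
    not_after 0 x (hsup _ hx)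
  generalize ((0 : ℕ) : ZMod k) = a at *
  obtain ⟨u, c, hc, hcl⟩ := exists_isCycle_of_isPath (p := .cons h20 (p.concat h53.symm))
    (by simp [Walk.cons_isPath_iff, Walk.concat_isPath_iff, Walk.support_concat, hp, fresh])
    rfl (by simp) (adj25 _).symm
  refine ⟨u, c, hc, ?_⟩
  simp only [Walk.length_cons, Walk.length_concat] at hcl
  omega

lemma exists_cycle_around (hk : 2 ≤ k) {n : ℕ} (h1 : 3 * k ≤ n) (h2 : n ≤ 6 * k) :
    ∃ (u : ZMod k × Fin 6) (c : (Fgraph k).Walk u u), c.IsCycle ∧ c.length = n := by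
  obtain ⟨s, m, hs, hm1, hm2, rfl⟩ : ∃ s m, (2 ≤ s ∧ s ≤ 5) ∧ 3 * (k - 1) ≤ m ∧
      m ≤ 6 * (k - 1) ∧ n = m + s + 1 := by
    by_cases h : n ≤ 3 * k + 3
    · exact ⟨n - 1 - 3 * (k - 1), 3 * (k - 1), by omega, by omega, by omega, by omega⟩
    · exact ⟨5, n - 6, by omega, by omega, by omega, by omega⟩
  obtain ⟨p, hp, hl, hsup⟩ := exists_path_top (k := k) (k - 1) 0 m (by omega) hm1 hm2
  obtain ⟨q, hq, hql, -⟩ := exists_path_through hs p hp hl hsup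
  have ha : (Fgraph k).Adj (((k - 1 : ℕ) : ZMod k), 2) (((0 : ℕ) : ZMod k), 0) := by
    simpa [Nat.cast_sub (show 1 ≤ k by omega)] using adj20 ((k - 1 : ℕ) : ZMod k)
  exact exists_isCycle_of_isPath hq hql (by omega) ha

end Fgraph

/-- `F_k` contains a cycle of every length in `{4} ∪ {3m+2 : 1 ≤ m ≤ k-1} ∪ [3k, 6k]`. -/
theorem Fgraph_cycle_lengths_present (k : ℕ) (hk : 2 ≤ k) :
    ∀ ℓ : ℕ,
      (ℓ = 4 ∨ (∃ m : ℕ, 1 ≤ m ∧ m ≤ k - 1 ∧ ℓ = 3 * m + 2) ∨ (3 * k ≤ ℓ ∧ ℓ ≤ 6 * k)) →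
      ∃ (u : ZMod k × Fin 6) (c : (Fgraph k).Walk u u), c.IsCycle ∧ c.length = ℓ := by
  rintro ℓ (rfl | ⟨m, h1, h2, rfl⟩ | ⟨h1, h2⟩)
  · exact Fgraph.exists_cycle_four
  · exact Fgraph.exists_cycle_local (t := (m - 1) / 2) (by omega) (by omega)
  · exact Fgraph.exists_cycle_around hk h1 h2
end

section
/- For each integer k ≥ 2 there exists a 3-regular hamiltonian-connected simple graph on 6k vertices whose cycle spectrum equals {4} ∪ {3m+2 : 1 ≤ m ≤ k−1} ∪ {ℓ : 3k ≤ ℓ ≤ 6k}. -/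
namespace Necklace

/-- Adjacency inside one bead: the theta graph with branch vertices `2`, `3` and connecting paths
through `0`, through `1`, and through `4, 5`. -/
def Inner (r s : Fin 6) : Prop :=
  (r, s) ∈ [(0, 2), (0, 3), (1, 2), (1, 3), (2, 4), (3, 5), (4, 5)] ∨
    (s, r) ∈ [((0 : Fin 6), (2 : Fin 6)), (0, 3), (1, 2), (1, 3), (2, 4), (3, 5), (4, 5)]

instance : DecidableRel Inner := fun r s => by unfold Inner; infer_instance

/-- Adjacency between the right end of a bead and the left end of the next one. -/
def Link (r s : Fin 6) : Prop := r = 4 ∧ s = 0 ∨ r = 5 ∧ s = 1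

instance : DecidableRel Link := fun r s => by unfold Link; infer_instance

/-- The cyclic necklace of `k` beads. -/
def graph (k : ℕ) : SimpleGraph (ZMod k × Fin 6) where
  Adj x y := (x.1 = y.1 ∧ Inner x.2 y.2) ∨ (x.1 + 1 = y.1 ∧ Link x.2 y.2) ∨
    (y.1 + 1 = x.1 ∧ Link y.2 x.2)
  symm := ⟨by
    rintro x y (⟨h, h'⟩ | h | h)
    · exact Or.inl ⟨h.symm, h'.symm⟩
    · exact Or.inr (Or.inr h)
    · exact Or.inr (Or.inl h)⟩
  loopless := ⟨by
    rintro ⟨i, r⟩ (⟨-, h⟩ | ⟨-, h⟩ | ⟨-, h⟩) <;>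
      dsimp only at h <;> revert r <;> decide⟩

variable {k : ℕ}

theorem graph_adj {x y : ZMod k × Fin 6} : (graph k).Adj x y ↔ (x.1 = y.1 ∧ Inner x.2 y.2) ∨
    (x.1 + 1 = y.1 ∧ Link x.2 y.2) ∨ (y.1 + 1 = x.1 ∧ Link y.2 x.2) :=
  Iff.rfl

theorem adj_inner {i : ZMod k} {r s : Fin 6} (h : Inner r s) : (graph k).Adj (i, r) (i, s) :=
  Or.inl ⟨rfl, h⟩

theorem adj_link {i j : ZMod k} {r s : Fin 6} (hij : i + 1 = j) (h : Link r s) :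
    (graph k).Adj (i, r) (j, s) :=
  Or.inr (Or.inl ⟨hij, h⟩)

theorem ncard_triple {α β : Type*} (i j l : α) {r s t : β} (h₁ : r ≠ s) (h₂ : r ≠ t)
    (h₃ : s ≠ t) :
    ({(i, r), (j, s), (l, t)} : Set (α × β)).ncard = 3 := by
  rw [Set.ncard_eq_three]
  exact ⟨_, _, _, by simp [h₁], by simp [h₂], by simp [h₃], rfl⟩

theorem neighborSet_eq (i : ZMod k) :
    (graph k).neighborSet (i, 0) = {(i - 1, 4), (i, 2), (i, 3)} ∧
    (graph k).neighborSet (i, 1) = {(i - 1, 5), (i, 2), (i, 3)} ∧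
    (graph k).neighborSet (i, 2) = {(i, 0), (i, 1), (i, 4)} ∧
    (graph k).neighborSet (i, 3) = {(i, 0), (i, 1), (i, 5)} ∧
    (graph k).neighborSet (i, 4) = {(i + 1, 0), (i, 2), (i, 5)} ∧
    (graph k).neighborSet (i, 5) = {(i + 1, 1), (i, 3), (i, 4)} := by
  refine ⟨?_, ?_, ?_, ?_, ?_, ?_⟩ <;> ext ⟨j, s⟩ <;>
  · simp only [SimpleGraph.mem_neighborSet, graph, Set.mem_insert_iff, Set.mem_singleton_iff,
      Prod.mk.injEq, eq_sub_iff_add_eq]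
    fin_cases s <;> simp [Inner, Link, eq_comm]

theorem ncard_neighborSet (v : ZMod k × Fin 6) : ((graph k).neighborSet v).ncard = 3 := by
  obtain ⟨i, r⟩ := v
  obtain ⟨h0, h1, h2, h3, h4, h5⟩ := neighborSet_eq i
  fin_cases r
  · exact h0 ▸ ncard_triple _ _ _ (by decide) (by decide) (by decide)
  · exact h1 ▸ ncard_triple _ _ _ (by decide) (by decide) (by decide)
  · exact h2 ▸ ncard_triple _ _ _ (by decide) (by decide) (by decide)
  · exact h3 ▸ ncard_triple _ _ _ (by decide) (by decide) (by decide)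
  · exact h4 ▸ ncard_triple _ _ _ (by decide) (by decide) (by decide)
  · exact h5 ▸ ncard_triple _ _ _ (by decide) (by decide) (by decide)

theorem exists_path_of_isChain {V : Type*} {G : SimpleGraph V} {u v : V} {L : List V}
    (hc : L.IsChain G.Adj) (hn : L.Nodup) (hu : L.head? = some u) (hv : L.getLast? = some v) :
    ∃ p : G.Walk u v, p.IsPath ∧ p.support = L := by
  have hne : L ≠ [] := by rintro rfl; simp at hu
  obtain rfl : L.head hne = u := by simpa [List.head?_eq_some_head hne] using hu
  obtain rfl : L.getLast hne = v := by simpa [List.getLast?_eq_some_getLast hne] using hv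
  refine ⟨.ofSupport L hne hc, ?_, by simp⟩
  rw [SimpleGraph.Walk.isPath_def]
  simpa

theorem exists_cycle_of_isChain {V : Type*} {G : SimpleGraph V} {u v : V} {L : List V}
    (hc : L.IsChain G.Adj) (hn : L.Nodup) (hu : L.head? = some u) (hv : L.getLast? = some v)
    (huv : G.Adj v u) (hl : 3 ≤ L.length) :
    ∃ c : G.Walk v v, c.IsCycle ∧ c.length = L.length := by
  obtain ⟨p, hp, rfl⟩ := exists_path_of_isChain hc hn hu hv
  refine ⟨.cons huv p, ?_, by simp⟩
  rw [SimpleGraph.Walk.cons_isCycle_iff]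
  refine ⟨hp, fun h => ?_⟩
  rw [Sym2.eq_swap] at h
  have := hp.length_eq_one_of_mem_edges h
  simp [this] at hl

/-! ### Hamiltonian paths -/

/-- The list running through `t` consecutive beads starting at `s`, visiting `pre` in each bead on
the way out and `post` on the way back. -/
def nest (pre post : List (Fin 6)) : ℕ → ZMod k → List (ZMod k × Fin 6)
  | 0, _ => []
  | t + 1, s => pre.map (s, ·) ++ (nest pre post t (s + 1) ++ post.map (s, ·))

theorem length_nest (pre post : List (Fin 6)) (t : ℕ) (s : ZMod k) :
    (nest pre post t s).length = t * (pre ++ post).length := by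
  induction t generalizing s with
  | zero => simp [nest]
  | succ t ih => simp [nest, ih]; ring

theorem mem_nest {pre post : List (Fin 6)} {t : ℕ} (s : ZMod k) {i : ℕ} (hi : i < t) {r : Fin 6}
    (hr : r ∈ pre ++ post) : (s + i, r) ∈ nest pre post t s := by
  induction t generalizing s i with
  | zero => omega
  | succ t ih =>
    rcases i with _ | i
    · simp only [List.mem_append] at hr
      rcases hr with h | h <;> simp [nest, h]
    · have := ih (s + 1) (i := i) (by omega)
      simp only [nest, List.mem_append]
      right; left
      convert this using 2
      push_cast; ring

theorem isChain_nest_single (t : ℕ) (s e : ZMod k) (h : s + 1 + t = e) :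
    ((s, 4) :: (nest [0, 2, 1, 3, 5, 4] [] t (s + 1) ++ [(e, 0)])).IsChain (graph k).Adj ∧
    ((s, 5) :: (nest [1, 3, 0, 2, 4, 5] [] t (s + 1) ++ [(e, 1)])).IsChain (graph k).Adj := by
  induction t generalizing s with
  | zero =>
    have h : s + 1 = e := by simpa using h
    simp [nest, graph_adj, h, Link]
  | succ t ih =>
    have := ih (s + 1) (by rw [← h]; push_cast; ring)
    simp [nest, this, graph_adj, Link, Inner]

theorem isChain_nest_double (t : ℕ) (s e : ZMod k) (h : s + 1 + t = e) :
    ((s, 4) :: (nest [0, 2, 4] [] t (s + 1) ++ [(e, 0)])).IsChain (graph k).Adj ∧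
    ((s, 5) :: (nest [1, 3, 5] [] t (s + 1) ++ [(e, 1)])).IsChain (graph k).Adj := by
  induction t generalizing s with
  | zero =>
    have h : s + 1 = e := by simpa using h
    simp [nest, graph_adj, h, Link]
  | succ t ih =>
    have := ih (s + 1) (by rw [← h]; push_cast; ring)
    simp [nest, this, graph_adj, Link, Inner]

theorem isChain_nest_turn (t : ℕ) (s : ZMod k) :
    ((s, 4) :: (nest [0, 2, 4] [5, 3, 1] t (s + 1) ++ [(s, 5)])).IsChain (graph k).Adj := by
  induction t generalizing s with
  | zero => simp [nest, graph_adj, Inner]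
  | succ t ih =>
    have h1 := ih (s + 1)
    have h2 : List.IsChain (graph k).Adj [(s + 1, 5), (s + 1, 3), (s + 1, 1), (s, 5)] := by
      simp [graph_adj, Inner, Link]
    have h3 := List.IsChain.append_overlap
      (l₁ := (s + 1, 4) :: nest [0, 2, 4] [5, 3, 1] t (s + 1 + 1))
      (l₂ := [(s + 1, 5)]) (l₃ := [(s + 1, 3), (s + 1, 1), (s, 5)]) h1 h2 (by simp)
    simp only [List.cons_append, List.append_assoc, List.nil_append] at h3
    simp [nest, h3, graph_adj, Link, Inner]

/-- Adjacency in the necklace of two beads, indexed by `Bool`. -/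
def BaseAdj (x y : Bool × Fin 6) : Prop :=
  x.1 = y.1 ∧ Inner x.2 y.2 ∨ x.1 ≠ y.1 ∧ (Link x.2 y.2 ∨ Link y.2 x.2)

instance : DecidableRel BaseAdj := fun x y => by unfold BaseAdj; infer_instance

/-- How a strip of beads is inserted into the oriented edge from `r` to `s`: the residues visited
on the way out and on the way back. Here `m` is the number of edges joining the two sides of the
strip that the path uses. -/
def detour (m : ℕ) (r s : Fin 6) : List (Fin 6) × List (Fin 6) :=
  if (r, s) = (4, 0) then (if m = 2 then [0, 2, 4] else [0, 2, 1, 3, 5, 4], [])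
  else if (r, s) = (5, 1) then (if m = 2 then [1, 3, 5] else [1, 3, 0, 2, 4, 5], [])
  else if (r, s) = (4, 5) ∧ m = 0 then ([0, 2, 4], [5, 3, 1])
  else ([], [])

/-- The edge from `x` to `y` is to be read from left to right. -/
def Forward (x y : Bool × Fin 6) : Prop := x.1 = y.1 ∧ x.2 ≤ y.2 ∨ x.1 ≠ y.1 ∧ Link x.2 y.2

instance : DecidableRel Forward := fun x y => by unfold Forward; infer_instance

/-- Which strip is inserted into the edge from `x` to `y`, and which residues are visited in it. -/
def visited (m : Bool → ℕ) (x y : Bool × Fin 6) : Bool × List (Fin 6) :=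
  if Forward x y then (x.1, (detour (m x.1) x.2 y.2).1 ++ (detour (m x.1) x.2 y.2).2)
  else (y.1, (detour (m y.1) y.2 x.2).1 ++ (detour (m y.1) y.2 x.2).2)

/-- The residues visited in strip `f` by the expansion of a path in the two-bead necklace. -/
def residues (m : Bool → ℕ) (f : Bool) : List (Bool × Fin 6) → List (Fin 6)
  | x :: y :: l =>
    (if (visited m x y).1 = f then (visited m x y).2 else []) ++ residues m f (y :: l)
  | _ => []

/-- The number of edges between bead `f` and bead `!f`, on the right of `f`, used by a path. -/
def crossings (f : Bool) : List (Bool × Fin 6) → ℕ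
  | x :: y :: l =>
    (if x.1 ≠ y.1 ∧ (x.1 = f ∧ Link x.2 y.2 ∨ y.1 = f ∧ Link y.2 x.2) then 1 else 0) +
      crossings f (y :: l)
  | _ => 0

/-- The path `L` in the two-bead necklace expands to hamiltonian paths of longer necklaces. -/
def Expandable (u v : Bool × Fin 6) (L : List (Bool × Fin 6)) : Prop :=
  L.head? = some u ∧ L.getLast? = some v ∧ L.IsChain BaseAdj ∧ L.length = 12 ∧ (∀ x, x ∈ L) ∧
    ∀ f, (residues (crossings · L) f L).length = 6 ∧ ∀ r, r ∈ residues (crossings · L) f L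

instance (u v : Bool × Fin 6) : DecidablePred (Expandable u v) :=
  fun L => by unfold Expandable; infer_instance

/-- All extensions of the reversed path `p` by `n` further vertices. -/
def extensions : ℕ → List (Bool × Fin 6) → List (List (Bool × Fin 6))
  | 0, p => [p]
  | _ + 1, [] => []
  | n + 1, x :: p =>
    ([(x.1, 0), (x.1, 1), (x.1, 2), (x.1, 3), (x.1, 4), (x.1, 5), (!x.1, 0), (!x.1, 1), (!x.1, 4),
      (!x.1, 5)].filter fun y => BaseAdj x y ∧ y ∉ p).flatMap fun y => extensions n (y :: x :: p)

set_option maxRecDepth 100000 in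
theorem exists_expandable : ∀ u v : Bool × Fin 6, u ≠ v →
    ∃ L ∈ extensions 11 [v], Expandable u v L := by
  decide +kernel

section expand

variable (pos : Bool → ZMod k) (len : Bool → ℕ) (m : Bool → ℕ)

/-- The vertices inserted between `x` and `y`. -/
def inserted (x y : Bool × Fin 6) : List (ZMod k × Fin 6) :=
  if Forward x y then
    nest (detour (m x.1) x.2 y.2).1 (detour (m x.1) x.2 y.2).2 (len x.1) (pos x.1 + 1)
  else (nest (detour (m y.1) y.2 x.2).1 (detour (m y.1) y.2 x.2).2 (len y.1) (pos y.1 + 1)).reverse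

/-- The expansion of a path in the two-bead necklace: bead `f` is placed at `pos f`, and a strip of
`len f` beads is inserted after it. -/
def expand : List (Bool × Fin 6) → List (ZMod k × Fin 6)
  | [] => []
  | [x] => [(pos x.1, x.2)]
  | x :: y :: l => (pos x.1, x.2) :: (inserted pos len m x y ++ expand (y :: l))

theorem length_inserted (x y : Bool × Fin 6) :
    (inserted pos len m x y).length = len (visited m x y).1 * (visited m x y).2.length := by
  unfold inserted visited
  split_ifs <;> simp [length_nest]

theorem mem_inserted {x y : Bool × Fin 6} {r : Fin 6} (hr : r ∈ (visited m x y).2) {i : ℕ}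
    (hi : i < len (visited m x y).1) :
    (pos (visited m x y).1 + 1 + i, r) ∈ inserted pos len m x y := by
  unfold inserted visited at *
  split_ifs at * with h
  · exact mem_nest _ hi hr
  · exact List.mem_reverse.2 (mem_nest _ hi hr)

theorem length_expand (L : List (Bool × Fin 6)) : (expand pos len m L).length =
    L.length + len false * (residues m false L).length + len true * (residues m true L).length := by
  induction L using expand.induct with
  | case1 => simp [expand, residues]
  | case2 => simp [expand, residues]
  | case3 x y l ih =>
    simp only [expand, residues, List.length_cons, List.length_append, ih, length_inserted]
    rcases (visited m x y).1 <;> simp <;> ring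

theorem mem_expand {L : List (Bool × Fin 6)} {x : Bool × Fin 6} (hx : x ∈ L) :
    (pos x.1, x.2) ∈ expand pos len m L := by
  induction L using expand.induct with
  | case1 => simp at hx
  | case2 => simp_all [expand]
  | case3 y z l ih =>
    rcases List.mem_cons.1 hx with rfl | hx
    · simp [expand]
    · simp [expand, ih hx]

theorem mem_expand_of_mem_residues {L : List (Bool × Fin 6)} {f : Bool} {r : Fin 6}
    (hr : r ∈ residues m f L) {i : ℕ} (hi : i < len f) :
    (pos f + 1 + i, r) ∈ expand pos len m L := by
  induction L using expand.induct with
  | case1 => simp [residues] at hr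
  | case2 => simp [residues] at hr
  | case3 y z l ih =>
    simp only [residues, List.mem_append] at hr
    simp only [expand, List.mem_cons, List.mem_append]
    rcases hr with hr | hr
    · split_ifs at hr with h
      · subst h
        exact Or.inr (Or.inl (mem_inserted pos len m hr hi))
      · simp at hr
    · exact Or.inr (Or.inr (ih hr))

theorem head?_expand (L : List (Bool × Fin 6)) :
    (expand pos len m L).head? = L.head?.map fun x => (pos x.1, x.2) := by
  induction L using expand.induct <;> simp [expand]

theorem getLast?_expand (L : List (Bool × Fin 6)) :
    (expand pos len m L).getLast? = L.getLast?.map fun x => (pos x.1, x.2) := by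
  induction L using expand.induct with
  | case1 => simp [expand]
  | case2 => simp [expand]
  | case3 y z l ih =>
    rw [expand, ← List.cons_append, List.getLast?_append, ih, List.getLast?_cons_cons]
    rcases h : (z :: l).getLast? with _ | a
    · simp at h
    · simp

variable {pos len}

theorem isChain_detour (hpos : ∀ f, pos f + 1 + len f = pos !f) {x y : Bool × Fin 6}
    (h : BaseAdj x y) (hf : Forward x y) :
    ((pos x.1, x.2) :: (nest (detour (m x.1) x.2 y.2).1 (detour (m x.1) x.2 y.2).2 (len x.1)
      (pos x.1 + 1) ++ [(pos y.1, y.2)])).IsChain (graph k).Adj := by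
  obtain ⟨f, r⟩ := x
  obtain ⟨g, s⟩ := y
  have key : (f = g ∧ Inner r s ∧ detour (m f) r s = ([], [])) ∨
      (f = g ∧ r = 4 ∧ s = 5 ∧ detour (m f) r s = ([0, 2, 4], [5, 3, 1])) ∨
      (g = !f ∧ r = 4 ∧ s = 0) ∨ (g = !f ∧ r = 5 ∧ s = 1) := by
    rcases h with ⟨rfl, h⟩ | ⟨hfg, -⟩
    · have hle : r ≤ s := by simpa [Forward] using hf
      by_cases hr : (r, s) = (4, 5) ∧ m f = 0
      · right; left
        obtain ⟨hrs, hm⟩ := hr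
        obtain ⟨rfl, rfl⟩ := Prod.mk.inj hrs
        simp [detour, hm]
      · left
        refine ⟨rfl, h, ?_⟩
        have h1 : (r, s) ≠ (4, 0) := by rintro h; obtain ⟨rfl, rfl⟩ := Prod.mk.inj h; simp at hle
        have h2 : (r, s) ≠ (5, 1) := by rintro h; obtain ⟨rfl, rfl⟩ := Prod.mk.inj h; simp at hle
        simp only [detour, h1, h2, hr, if_false]
    · have hg : g = !f := by cases f <;> cases g <;> simp_all
      have hl : Link r s := by simpa [Forward, hfg] using hf
      rcases hl with ⟨rfl, rfl⟩ | ⟨rfl, rfl⟩ <;> simp [hg]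
  rcases key with ⟨rfl, h, hd⟩ | ⟨rfl, rfl, rfl, hd⟩ | ⟨rfl, rfl, rfl⟩ | ⟨rfl, rfl, rfl⟩
  · have hn : ∀ t (s : ZMod k), nest [] [] t s = [] := by
      intro t; induction t <;> simp_all [nest]
    simp [hd, hn, adj_inner h]
  · simpa only [hd] using isChain_nest_turn (len f) (pos f)
  · by_cases hm : m f = 2
    · simpa [detour, hm] using (isChain_nest_double (len f) _ _ (hpos f)).1
    · simpa [detour, hm] using (isChain_nest_single (len f) _ _ (hpos f)).1
  · by_cases hm : m f = 2
    · simpa [detour, hm] using (isChain_nest_double (len f) _ _ (hpos f)).2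
    · simpa [detour, hm] using (isChain_nest_single (len f) _ _ (hpos f)).2

theorem isChain_inserted (hpos : ∀ f, pos f + 1 + len f = pos !f) {x y : Bool × Fin 6}
    (h : BaseAdj x y) :
    ((pos x.1, x.2) :: (inserted pos len m x y ++ [(pos y.1, y.2)])).IsChain (graph k).Adj := by
  unfold inserted
  split_ifs with hf
  · exact isChain_detour m hpos h hf
  · have h' : BaseAdj y x ∧ Forward y x := by
      revert x y; decide
    have := isChain_detour m hpos h'.1 h'.2
    rw [← List.isChain_reverse]
    simpa [SimpleGraph.adj_comm] using this

theorem isChain_expand (hpos : ∀ f, pos f + 1 + len f = pos !f) {L : List (Bool × Fin 6)}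
    (h : L.IsChain BaseAdj) : (expand pos len m L).IsChain (graph k).Adj := by
  induction L using expand.induct with
  | case1 => simp [expand]
  | case2 => simp [expand]
  | case3 y z l ih =>
    rw [List.isChain_cons_cons] at h
    have h1 := isChain_inserted m hpos h.1
    have h2 := ih h.2
    rw [expand]
    obtain ⟨T, hT⟩ : ∃ T, expand pos len m (z :: l) = (pos z.1, z.2) :: T := by
      cases l <;> exact ⟨_, rfl⟩
    rw [hT] at h2 ⊢
    have := List.IsChain.append_overlap (l₁ := (pos y.1, y.2) :: inserted pos len m y z)
      (l₂ := [(pos z.1, z.2)]) (l₃ := T) h1 h2 (by simp)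
    simpa using this

end expand

theorem exists_path_expand [NeZero k] {pos : Bool → ZMod k} {len : Bool → ℕ}
    (hpos : ∀ f, pos f + 1 + len f = pos !f) (hk : len false + len true + 2 = k)
    {u v : Bool × Fin 6} (huv : u ≠ v) :
    ∃ p : (graph k).Walk (pos u.1, u.2) (pos v.1, v.2), p.IsPath ∧ ∀ w, w ∈ p.support := by
  obtain ⟨L, -, hu, hv, hc, hl, hm, hr⟩ := exists_expandable u v huv
  have hmem : ∀ w, w ∈ expand pos len (crossings · L) L := by
    have hcover : ∀ z : ZMod k, ∃ f, z = pos f ∨ ∃ i < len f, z = pos f + 1 + (i : ℕ) := by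
      intro z
      obtain ⟨n, hn, rfl⟩ : ∃ n < k, z = pos false + (n : ℕ) :=
        ⟨(z - pos false).val, ZMod.val_lt _, by simp⟩
      rcases lt_trichotomy n (len false + 1) with h | rfl | h
      · rcases n with _ | n
        · exact ⟨false, Or.inl (by simp)⟩
        · exact ⟨false, Or.inr ⟨n, by omega, by push_cast; ring⟩⟩
      · exact ⟨true, Or.inl (by rw [← Bool.not_false, ← hpos]; push_cast; ring)⟩
      · refine ⟨true, Or.inr ⟨n - (len false + 2), by omega, ?_⟩⟩
        obtain ⟨j, rfl⟩ : ∃ j, n = len false + 2 + j := ⟨n - (len false + 2), by omega⟩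
        rw [← Bool.not_false, ← hpos, Nat.add_sub_cancel_left]
        push_cast; ring
    rintro ⟨z, r⟩
    obtain ⟨f, rfl | ⟨i, hi, rfl⟩⟩ := hcover z
    · exact mem_expand pos len _ (hm (f, r))
    · exact mem_expand_of_mem_residues pos len _ ((hr f).2 r) hi
  have hnodup : (expand pos len (crossings · L) L).Nodup := by
    rw [← Multiset.coe_nodup, ← Multiset.toFinset_card_eq_card_iff_nodup]
    have : (expand pos len (crossings · L) L : Multiset (ZMod k × Fin 6)).toFinset =
        Finset.univ := by
      ext w; simp [hmem w]
    rw [this, Multiset.coe_card, length_expand, (hr false).1, (hr true).1, hl, Finset.card_univ,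
      Fintype.card_prod, ZMod.card, Fintype.card_fin]
    omega
  obtain ⟨p, hp, hs⟩ := exists_path_of_isChain (u := (pos u.1, u.2)) (v := (pos v.1, v.2))
    (isChain_expand _ hpos hc) hnodup
    (by rw [head?_expand, hu]; rfl) (by rw [getLast?_expand, hv]; rfl)
  exact ⟨p, hp, fun w => hs ▸ hmem w⟩

theorem hamiltonianConnected (hk : 2 ≤ k) : (graph k).HamiltonianConnected := by
  have : NeZero k := ⟨by omega⟩
  rintro ⟨i, r⟩ ⟨j, s⟩ huv
  obtain ⟨n, hn, rfl⟩ : ∃ n < k, j = i + (n : ℕ) :=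
    ⟨(j - i).val, ZMod.val_lt _, by simp⟩
  have hcast : ((k : ℕ) : ZMod k) = 0 := ZMod.natCast_self k
  have hpos : ∀ p q : ℕ, p + q + 2 = k → ∀ f,
      (Bool.rec i (i + 1 + p) f : ZMod k) + 1 + ((Bool.rec p q f : ℕ) : ZMod k) =
        Bool.rec i (i + 1 + p) !f := by
    rintro p q h (_ | _)
    · rfl
    · have : ((p + q + 2 : ℕ) : ZMod k) = 0 := by rw [h, hcast]
      push_cast at this
      simp only [Bool.not_true]
      linear_combination this
  rcases n with _ | n
  · have := exists_path_expand (hpos 0 (k - 2) (by omega)) (by simp; omega) (u := (false, r))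
      (v := (false, s)) (by rintro h; simp_all)
    have e : i + ((0 : ℕ) : ZMod k) = i := by simp
    rw [e]
    exact this
  · have := exists_path_expand (hpos n (k - 2 - n) (by omega)) (by simp; omega) (u := (false, r))
      (v := (true, s)) (by simp)
    have e : i + ((n + 1 : ℕ) : ZMod k) = i + 1 + n := by push_cast; ring
    rw [e]
    exact this
/-! ### Existence of cycles -/

theorem natCast_inj_of_lt {i j : ℕ} (hi : i < k) (hj : j < k) (h : (i : ZMod k) = j) : i = j := by
  rwa [ZMod.natCast_eq_natCast_iff', Nat.mod_eq_of_lt hi, Nat.mod_eq_of_lt hj] at h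

theorem exists_bead_path : ∀ n, 3 ≤ n → n ≤ 6 → ∃ P : List (Fin 6), P.IsChain Inner ∧ P.Nodup ∧
    P.head? = some 0 ∧ P.getLast? = some 4 ∧ P.length = n := by
  intro n h₁ h₂
  interval_cases n
  · exact ⟨[0, 2, 4], by decide⟩
  · exact ⟨[0, 3, 5, 4], by decide⟩
  · exact ⟨[0, 3, 1, 2, 4], by decide⟩
  · exact ⟨[0, 2, 1, 3, 5, 4], by decide⟩

theorem isChain_map_bead {P : List (Fin 6)} (h : P.IsChain Inner) (i : ZMod k) :
    (P.map (i, ·)).IsChain (graph k).Adj :=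
  List.isChain_map_of_isChain (fun r => (i, r)) (fun _ _ hrs => adj_inner hrs) h

theorem nodup_map_bead {P : List (Fin 6)} (h : P.Nodup) (i : ZMod k) : (P.map (i, ·)).Nodup :=
  h.map (Prod.mk_right_injective i)

theorem exists_traversal (t : ℕ) (ht : t < k) (l : ℕ) (h₁ : 3 * (t + 1) ≤ l)
    (h₂ : l ≤ 6 * (t + 1)) : ∃ L : List (ZMod k × Fin 6), L.IsChain (graph k).Adj ∧ L.Nodup ∧
      L.head? = some (0, 0) ∧ L.getLast? = some ((t : ZMod k), 4) ∧ L.length = l ∧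
      ∀ x ∈ L, ∃ i ≤ t, x.1 = (i : ℕ) := by
  induction t generalizing l with
  | zero =>
    obtain ⟨P, hP, hn, hh, hl, rfl⟩ := exists_bead_path l h₁ h₂
    refine ⟨_, isChain_map_bead hP 0, nodup_map_bead hn 0, by simp [hh], by simp [hl], by simp,
      fun x hx => ⟨0, le_rfl, ?_⟩⟩
    obtain ⟨r, -, rfl⟩ := List.mem_map.1 hx
    simp
  | succ t ih =>
    obtain ⟨a, b, rfl, ha, ha', hb, hb'⟩ : ∃ a b, l = a + b ∧ 3 * (t + 1) ≤ a ∧ a ≤ 6 * (t + 1) ∧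
        3 ≤ b ∧ b ≤ 6 := by
      by_cases h : l ≤ 6 * (t + 1) + 3
      · exact ⟨l - 3, 3, by omega⟩
      · exact ⟨6 * (t + 1), l - 6 * (t + 1), by omega⟩
    obtain ⟨L, hL, hLn, hLh, hLl, rfl, hLm⟩ := ih (by omega) a ha ha'
    obtain ⟨P, hP, hn, hh, hl, rfl⟩ := exists_bead_path b hb hb'
    refine ⟨L ++ P.map (((t + 1 : ℕ) : ZMod k), ·), ?_, ?_, by simp [hLh], by simp [hl],
      by simp, ?_⟩
    · refine hL.append (isChain_map_bead hP _) ?_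
      simp only [hLl, hh, List.head?_map, Option.map_some, Option.mem_def, Option.some.injEq]
      rintro _ rfl _ rfl
      exact adj_link (by push_cast; rfl) (by decide)
    · refine hLn.append (nodup_map_bead hn _) fun x hx hx' => ?_
      obtain ⟨i, hi, hxi⟩ := hLm x hx
      obtain ⟨r, -, rfl⟩ := List.mem_map.1 hx'
      have := natCast_inj_of_lt ht (by omega) hxi
      omega
    · intro x hx
      rcases List.mem_append.1 hx with hx | hx
      · obtain ⟨i, hi, hxi⟩ := hLm x hx
        exact ⟨i, by omega, hxi⟩
      · obtain ⟨r, -, rfl⟩ := List.mem_map.1 hx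
        exact ⟨t + 1, le_rfl, rfl⟩

theorem exists_turn (t : ℕ) (ht : t < k) : ∃ L : List (ZMod k × Fin 6),
    L.IsChain (graph k).Adj ∧ L.Nodup ∧ L.head? = some ((t : ZMod k), 4) ∧
      L.getLast? = some ((t : ZMod k), 5) ∧ L.length = 6 * t + 2 ∧
      ∀ x ∈ L, ∃ i ≤ t, x.1 = (i : ℕ) := by
  induction t with
  | zero => exact ⟨[(0, 4), (0, 5)], by simp [graph_adj, Inner]⟩
  | succ t ih =>
    obtain ⟨L, hL, hLn, hLh, hLl, hlen, hLm⟩ := ih (by omega)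
    have hnot : ∀ r, (((t + 1 : ℕ) : ZMod k), r) ∉ L := fun r hr => by
      obtain ⟨i, hi, hxi⟩ := hLm _ hr
      have := natCast_inj_of_lt ht (by omega) hxi
      omega
    refine ⟨[4, 2, 0].map (((t + 1 : ℕ) : ZMod k), ·) ++
      (L ++ [1, 3, 5].map (((t + 1 : ℕ) : ZMod k), ·)), ?_, ?_, by simp,
      by rw [← List.append_assoc, List.getLast?_append]; simp, by simp [hlen]; ring, ?_⟩
    · refine (isChain_map_bead (by decide) _).append
        (hL.append (isChain_map_bead (by decide) _) ?_) ?_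
      · simp only [hLl, List.map_cons, List.head?_cons, Option.mem_def, Option.some.injEq]
        rintro _ rfl _ rfl
        exact adj_link (by push_cast; rfl) (by decide)
      · rw [List.head?_append, hLh]
        simp only [List.map_cons, List.map_nil, List.getLast?_cons_cons, List.getLast?_singleton,
          Option.some_or, Option.mem_def, Option.some.injEq]
        rintro _ rfl _ rfl
        exact (adj_link (by push_cast; rfl) (by decide)).symm
    · simp only [List.map_cons, List.map_nil, List.nodup_append, List.mem_append]
      refine ⟨by simp, ⟨hLn, by simp, ?_⟩, ?_⟩
      · rintro x hx y hy rfl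
        simp only [List.mem_cons, List.not_mem_nil, or_false] at hy
        rcases hy with rfl | rfl | rfl <;> exact hnot _ hx
      · rintro x hx y hy rfl
        simp only [List.mem_cons, List.not_mem_nil, or_false] at hx
        rcases hy with hy | hy
        · rcases hx with rfl | rfl | rfl <;> exact hnot _ hy
        · rcases hx with rfl | rfl | rfl <;> simp at hy
    · intro x hx
      simp only [List.mem_append] at hx
      rcases hx with hx | hx | hx
      · obtain ⟨r, -, rfl⟩ := List.mem_map.1 hx
        exact ⟨t + 1, le_rfl, rfl⟩
      · obtain ⟨i, hi, hxi⟩ := hLm x hx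
        exact ⟨i, by omega, hxi⟩
      · obtain ⟨r, -, rfl⟩ := List.mem_map.1 hx
        exact ⟨t + 1, le_rfl, rfl⟩

theorem exists_cycle_of_turn (t : ℕ) (ht : t + 1 < k) {P : List (Fin 6)} (hP : P.IsChain Inner)
    (hn : P.Nodup) (hh : P.head? = some 1) (hl : P.getLast? = some 0) :
    ∃ (u : ZMod k × Fin 6) (c : (graph k).Walk u u), c.IsCycle ∧
      c.length = 6 * t + 2 + P.length := by
  obtain ⟨L, hL, hLn, hLh, hLl, hlen, hLm⟩ := exists_turn t (show t < k by omega)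
  have hPl : 0 < P.length := List.length_pos_iff.2 (by rintro rfl; simp at hh)
  obtain ⟨c, hc, hc'⟩ := exists_cycle_of_isChain (G := graph k)
    (L := L ++ P.map (((t + 1 : ℕ) : ZMod k), ·)) (u := ((t : ZMod k), 4))
    (v := (((t + 1 : ℕ) : ZMod k), 0))
    (by
      refine hL.append (isChain_map_bead hP _) ?_
      simp only [hLl, hh, List.head?_map, Option.map_some, Option.mem_def, Option.some.injEq]
      rintro _ rfl _ rfl
      exact adj_link (by push_cast; rfl) (by decide))
    (by
      refine hLn.append (nodup_map_bead hn _) fun x hx hx' => ?_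
      obtain ⟨i, hi, hxi⟩ := hLm x hx
      obtain ⟨r, -, rfl⟩ := List.mem_map.1 hx'
      have := natCast_inj_of_lt ht (by omega) hxi
      omega)
    (by simp [hLh]) (by simp [hl]) (adj_link (by push_cast; rfl) (by decide)).symm
    (by simp [hlen]; omega)
  exact ⟨_, c, hc, by simp [hc', hlen]⟩

theorem exists_cycle (hk : 2 ≤ k) {l : ℕ}
    (hl : l = 4 ∨ (∃ m : ℕ, 1 ≤ m ∧ m ≤ k - 1 ∧ l = 3 * m + 2) ∨ (3 * k ≤ l ∧ l ≤ 6 * k)) :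
    ∃ (u : ZMod k × Fin 6) (c : (graph k).Walk u u), c.IsCycle ∧ c.length = l := by
  rcases hl with rfl | ⟨m, hm, hmk, rfl⟩ | ⟨h₁, h₂⟩
  · obtain ⟨c, hc⟩ := exists_cycle_of_isChain
      (isChain_map_bead (k := k) (P := [0, 2, 1, 3]) (by decide) 0) (nodup_map_bead (by decide) _)
      rfl rfl (adj_inner (by decide)) (by simp)
    exact ⟨_, c, hc⟩
  · rcases Nat.even_or_odd' m with ⟨t, rfl | rfl⟩
    · obtain ⟨u, c, hc, h⟩ := exists_cycle_of_turn (k := k) (t - 1) (by omega)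
        (P := [1, 3, 5, 4, 2, 0]) (by decide) (by decide) rfl rfl
      exact ⟨u, c, hc, by rw [h]; simp; omega⟩
    · obtain ⟨u, c, hc, h⟩ := exists_cycle_of_turn (k := k) t (by omega)
        (P := [1, 2, 0]) (by decide) (by decide) rfl rfl
      exact ⟨u, c, hc, by rw [h]; simp; omega⟩
  · obtain ⟨L, hL, hn, hh, hlast, rfl, -⟩ := exists_traversal (k := k) (k - 1) (by omega) l
      (by omega) (by omega)
    obtain ⟨c, hc⟩ := exists_cycle_of_isChain hL hn hh hlast
      (adj_link (by
        have : ((k - 1 + 1 : ℕ) : ZMod k) = 0 := by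
          rw [Nat.sub_add_cancel (by omega), ZMod.natCast_self]
        exact_mod_cast this) (by decide)) (by omega)
    exact ⟨_, c, hc⟩

/-! ### Lengths of cycles -/

/-- A vertex with incident edges `p`, `q`, `r` has degree two if `s` holds, and zero otherwise. -/
def Deg (s p q r : Bool) : Prop := p.toNat + q.toNat + r.toNat = 2 * s.toNat

instance (s p q r : Bool) : Decidable (Deg s p q r) := by unfold Deg; infer_instance

set_option synthInstance.maxSize 2000 in
set_option synthInstance.maxHeartbeats 400000 in
theorem bead_cases : ∀ a s0 e02 e03, Deg s0 a e02 e03 → ∀ b s1 e12 e13, Deg s1 b e12 e13 →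
    ∀ s2 e24, Deg s2 e02 e12 e24 → ∀ s3 e35, Deg s3 e03 e13 e35 →
    ∀ c s4 e45, Deg s4 c e24 e45 → ∀ d s5, Deg s5 d e35 e45 →
    ∀ n, n = s0.toNat + s1.toNat + s2.toNat + s3.toNat + s4.toNat + s5.toNat →
    a.toNat + b.toNat = 1 ∧ c.toNat + d.toNat = 1 ∧ 3 ≤ n ∨
    a.toNat + b.toNat = 0 ∧ c.toNat + d.toNat = 0 ∧ (n = 0 ∨ n = 4 ∨ n = 5) ∨
    a.toNat + b.toNat = 2 ∧ c.toNat + d.toNat = 0 ∧ n % 3 = 0 ∧ 0 < n ∨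
    a.toNat + b.toNat = 0 ∧ c.toNat + d.toNat = 2 ∧ (n = 2 ∨ n = 5) ∨
    a.toNat + b.toNat = 2 ∧ c.toNat + d.toNat = 2 ∧ n = 6 ∨
    a.toNat + b.toNat ≠ 1 ∧ c.toNat + d.toNat = 2 ∧ 5 ≤ n ∧ s0 ∧ s4 ∧ !e24 ∧ !e35 := by
  simp only [forall_eq]
  decide +kernel

theorem mem_of_ncard_eq_two {V : Type*} {T : Set V} {p q r : V} (hT : T ⊆ {p, q, r})
    (h : T.ncard = 2) (hpq : p ≠ q) (hpr : p ≠ r) (hqr : q ≠ r) :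
    p ∉ T ∧ q ∈ T ∧ r ∈ T ∨ p ∈ T ∧ q ∉ T ∧ r ∈ T ∨ p ∈ T ∧ q ∈ T ∧ r ∉ T := by
  classical
  obtain ⟨x, y, hxy, rfl⟩ := Set.ncard_eq_two.1 h
  have hx := hT (Set.mem_insert x {y})
  have hy := hT (Set.mem_insert_of_mem x (Set.mem_singleton y))
  simp only [Set.mem_insert_iff, Set.mem_singleton_iff] at hx hy ⊢
  grind

section cycle

open Classical in
/-- Whether the walk uses the edge between `x` and `y`. -/
noncomputable def uses {u : ZMod k × Fin 6} (c : (graph k).Walk u u)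
    (x y : ZMod k × Fin 6) : Bool :=
  decide (c.toSubgraph.Adj x y)

open Classical in
/-- Whether the walk visits `x`. -/
noncomputable def visits {u : ZMod k × Fin 6} (c : (graph k).Walk u u)
    (x : ZMod k × Fin 6) : Bool :=
  decide (x ∈ c.support)

/-- The number of edges between beads `i` and `i + 1` used by a walk. -/
noncomputable def cut {u : ZMod k × Fin 6} (c : (graph k).Walk u u) (i : ZMod k) : ℕ :=
  (uses c (i, 4) (i + 1, 0)).toNat + (uses c (i, 5) (i + 1, 1)).toNat

/-- The number of vertices of bead `i` visited by a walk. -/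
noncomputable def load {u : ZMod k × Fin 6} (c : (graph k).Walk u u) (i : ZMod k) : ℕ :=
  ∑ r, (visits c (i, r)).toNat

variable {u : ZMod k × Fin 6} {c : (graph k).Walk u u}

theorem deg_of_isCycle (hc : c.IsCycle) {x p q r : ZMod k × Fin 6}
    (hN : (graph k).neighborSet x = {p, q, r}) (hpq : p.2 ≠ q.2) (hpr : p.2 ≠ r.2)
    (hqr : q.2 ≠ r.2) : Deg (visits c x) (uses c x p) (uses c x q) (uses c x r) := by
  by_cases hx : x ∈ c.support
  · have h2 := hc.ncard_neighborSet_toSubgraph_eq_two hx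
    have hsub : c.toSubgraph.neighborSet x ⊆ {p, q, r} :=
      hN ▸ c.toSubgraph.neighborSet_subset x
    have := mem_of_ncard_eq_two hsub h2 (by rintro rfl; simp at hpq) (by rintro rfl; simp at hpr)
      (by rintro rfl; simp at hqr)
    simp only [SimpleGraph.Subgraph.mem_neighborSet] at this
    rcases this with ⟨h₁, h₂, h₃⟩ | ⟨h₁, h₂, h₃⟩ | ⟨h₁, h₂, h₃⟩ <;>
      simp [Deg, visits, uses, hx, h₁, h₂, h₃]
  · have : ∀ y, ¬ c.toSubgraph.Adj x y := fun y h =>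
      hx (c.mem_verts_toSubgraph.1 (c.toSubgraph.edge_vert h))
    simp [Deg, visits, uses, hx, this]

theorem uses_comm (c : (graph k).Walk u u) (x y : ZMod k × Fin 6) : uses c x y = uses c y x := by
  classical exact decide_eq_decide.2 (c.toSubgraph.adj_comm x y)

theorem load_cases (hc : c.IsCycle) (i : ZMod k) :
    cut c i = 1 ∧ cut c (i + 1) = 1 ∧ 3 ≤ load c (i + 1) ∨
    cut c i = 0 ∧ cut c (i + 1) = 0 ∧
      (load c (i + 1) = 0 ∨ load c (i + 1) = 4 ∨ load c (i + 1) = 5) ∨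
    cut c i = 2 ∧ cut c (i + 1) = 0 ∧ load c (i + 1) % 3 = 0 ∧ 0 < load c (i + 1) ∨
    cut c i = 0 ∧ cut c (i + 1) = 2 ∧ (load c (i + 1) = 2 ∨ load c (i + 1) = 5) ∨
    cut c i = 2 ∧ cut c (i + 1) = 2 ∧ load c (i + 1) = 6 ∨
    cut c i ≠ 1 ∧ cut c (i + 1) = 2 ∧ 5 ≤ load c (i + 1) ∧ visits c (i + 1, 0) ∧
      visits c (i + 1, 4) ∧ !uses c (i + 1, 2) (i + 1, 4) ∧ !uses c (i + 1, 3) (i + 1, 5) := by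
  obtain ⟨h0, h1, h2, h3, h4, h5⟩ := neighborSet_eq (i + 1)
  rw [add_sub_cancel_right] at h0 h1
  have d0 := deg_of_isCycle hc h0 (by simp) (by simp) (by simp)
  have d1 := deg_of_isCycle hc h1 (by simp) (by simp) (by simp)
  have d2 := deg_of_isCycle hc h2 (by simp) (by simp) (by simp)
  have d3 := deg_of_isCycle hc h3 (by simp) (by simp) (by simp)
  have d4 := deg_of_isCycle hc h4 (by simp) (by simp) (by simp)
  have d5 := deg_of_isCycle hc h5 (by simp) (by simp) (by simp)
  rw [uses_comm c _ (i, 4)] at d0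
  rw [uses_comm c _ (i, 5)] at d1
  rw [uses_comm c _ (i + 1, 0), uses_comm c _ (i + 1, 1)] at d2 d3
  rw [uses_comm c _ (i + 1, 2)] at d4
  rw [uses_comm c _ (i + 1, 3), uses_comm c _ (i + 1, 4)] at d5
  exact bead_cases _ _ _ _ d0 _ _ _ _ d1 _ _ d2 _ _ d3 _ _ _ d4 _ _ d5 _
    (Fin.sum_univ_six _)

theorem length_eq_sum_load [NeZero k] (hc : c.IsCycle) : c.length = ∑ i, load c i := by
  classical
  have h1 : c.support.tail.toFinset.card = c.length := by
    rw [List.toFinset_card_of_nodup hc.support_nodup]; simp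
  have h2 : c.support.tail.toFinset = Finset.univ.filter (· ∈ c.support) := by
    ext x
    simp only [List.mem_toFinset, Finset.mem_filter, Finset.mem_univ, true_and]
    refine ⟨List.mem_of_mem_tail, fun h => ?_⟩
    rcases (c.mem_support_iff).1 h with rfl | h
    exacts [SimpleGraph.Walk.end_mem_tail_support hc.not_nil, h]
  rw [← h1, h2, Finset.card_filter]
  simp only [load]
  rw [Fintype.sum_prod_type]
  refine Finset.sum_congr rfl fun i _ => Finset.sum_congr rfl fun r _ => ?_
  by_cases h : (i, r) ∈ c.support <;> simp [visits, h]

theorem mem_of_closed {V : Type*} {G : SimpleGraph V} {u : V} {c : G.Walk u u} {X : Set V} {x : V}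
    (hx : x ∈ c.support) (hxX : x ∈ X) (hX : ∀ y z, c.toSubgraph.Adj y z → y ∈ X → z ∈ X) :
    ∀ y ∈ c.support, y ∈ X := by
  intro y hy
  have hconn := c.toSubgraph_connected
  obtain ⟨p⟩ := hconn.coe.preconnected ⟨x, c.mem_verts_toSubgraph.2 hx⟩
    ⟨y, c.mem_verts_toSubgraph.2 hy⟩
  have : ∀ a b : c.toSubgraph.verts, c.toSubgraph.coe.Walk a b → (a : V) ∈ X → (b : V) ∈ X := by
    intro a b q
    induction q with
    | nil => exact id
    | cons h q ih => exact fun ha => ih (hX _ _ h ha)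
  exact this _ _ p hxX

theorem not_adj_of_cut_eq_zero {i j : ZMod k} {r s : Fin 6} (h : cut c i = 0) (hij : i + 1 = j)
    (hrs : Link r s) : ¬ c.toSubgraph.Adj (i, r) (j, s) := by
  subst hij
  simp only [cut, Nat.add_eq_zero_iff, Bool.toNat_eq_zero, uses, decide_eq_false_iff_not] at h
  rcases hrs with ⟨rfl, rfl⟩ | ⟨rfl, rfl⟩
  exacts [h.1, h.2]

theorem mem_initial_beads {z : ZMod k} {t : ℕ} (hz : cut c z = 0) (ht : cut c (z + 1 + t) = 0)
    {x : ZMod k × Fin 6} (hx : x ∈ c.support) (hxt : ∃ i ≤ t, x.1 = z + 1 + (i : ℕ)) :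
    ∀ y ∈ c.support, ∃ i ≤ t, y.1 = z + 1 + (i : ℕ) := by
  suffices ∀ y y', c.toSubgraph.Adj y y' →
      y ∈ {y : ZMod k × Fin 6 | ∃ i ≤ t, y.1 = z + 1 + (i : ℕ)} →
      y' ∈ {y : ZMod k × Fin 6 | ∃ i ≤ t, y.1 = z + 1 + (i : ℕ)} from mem_of_closed hx hxt this
  rintro ⟨i, r⟩ ⟨j, s⟩ hadj ⟨n, hn, hi⟩
  dsimp only at hi
  rcases graph_adj.1 hadj.adj_sub with ⟨h, -⟩ | ⟨h, hl⟩ | ⟨h, hl⟩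
  · exact ⟨n, hn, h ▸ hi⟩
  · rcases hn.lt_or_eq with hn | rfl
    · exact ⟨n + 1, hn, by dsimp only at h ⊢; rw [← h, hi]; push_cast; ring⟩
    · exact absurd hadj (not_adj_of_cut_eq_zero (hi ▸ ht) h hl)
  · rcases n with _ | n
    · have hj : j = z := by simpa [hi] using h
      exact absurd hadj.symm (not_adj_of_cut_eq_zero (hj ▸ hz) h hl)
    · refine ⟨n, by omega, ?_⟩
      dsimp only at h ⊢
      rw [hi] at h
      push_cast at h
      linear_combination h

theorem not_visits_of_turn {z : ZMod k} {t : ℕ} (htk : t < k) (hz : cut c z = 0)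
    (h0 : visits c (z + 1 + t, 0)) (h24 : !uses c (z + 1 + t, 2) (z + 1 + t, 4))
    (h35 : !uses c (z + 1 + t, 3) (z + 1 + t, 5)) : ¬ visits c (z + 1 + t, 4) := by
  simp only [visits, uses, decide_eq_true_eq, Bool.not_eq_true', decide_eq_false_iff_not] at *
  intro h4
  refine ((mem_of_closed (X := {y | (∃ i ≤ t, y.1 = z + 1 + (i : ℕ)) ∧
    (y.1 = z + 1 + (t : ℕ) → y.2 ≠ 4 ∧ y.2 ≠ 5)}) h0 ⟨⟨t, le_rfl, rfl⟩, by simp⟩ ?_ _ h4).2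
    rfl).1 rfl
  rintro ⟨i, r⟩ ⟨j, s⟩ hadj ⟨⟨n, hn, hi⟩, hit⟩
  dsimp only at hi hit
  rcases graph_adj.1 hadj.adj_sub with ⟨h, hl⟩ | ⟨h, hl⟩ | ⟨h, hl⟩ <;> dsimp only at h hl
  · subst h
    refine ⟨⟨n, hn, hi⟩, fun h => ?_⟩
    dsimp only at h ⊢
    obtain ⟨h4, h5⟩ := hit h
    subst h
    have key : ∀ r s : Fin 6, Inner r s → r ≠ 4 → r ≠ 5 → (s = 4 ∨ s = 5) →
        r = 2 ∧ s = 4 ∨ r = 3 ∧ s = 5 := by decide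
    by_contra hs
    rcases key r s hl h4 h5 (by tauto) with ⟨rfl, rfl⟩ | ⟨rfl, rfl⟩
    exacts [h24 hadj, h35 hadj]
  · have hs : s ≠ 4 ∧ s ≠ 5 := by rcases hl with ⟨-, rfl⟩ | ⟨-, rfl⟩ <;> decide
    refine ⟨?_, fun _ => hs⟩
    rcases hn.lt_or_eq with hn | rfl
    · exact ⟨n + 1, hn, by rw [← h, hi]; push_cast; ring⟩
    · obtain ⟨h4, h5⟩ := hit hi
      rcases hl with ⟨rfl, -⟩ | ⟨rfl, -⟩ <;> contradiction
  · rcases n with _ | n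
    · have hj : j = z := by simpa [hi] using h
      exact absurd hadj.symm (not_adj_of_cut_eq_zero (hj ▸ hz) h hl)
    · have hj : j = z + 1 + (n : ℕ) := by
        rw [hi] at h
        push_cast at h
        linear_combination h
      refine ⟨⟨n, by omega, hj⟩, fun h' => ?_⟩
      have := natCast_inj_of_lt (by omega) htk (add_left_cancel (hj.symm.trans h'))
      omega

theorem length_eq_sum_range [NeZero k] (hc : c.IsCycle) (z : ZMod k) :
    c.length = ∑ i ∈ Finset.range k, load c (z + 1 + (i : ℕ)) := by
  rw [length_eq_sum_load hc]
  symm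
  refine Finset.sum_nbij (fun i : ℕ => z + 1 + (i : ZMod k)) (by simp) ?_ ?_ (by simp)
  · intro i hi j hj h
    exact natCast_inj_of_lt (by simpa using hi) (by simpa using hj) (add_left_cancel h)
  · intro y _
    exact ⟨(y - (z + 1)).val, by simpa using ZMod.val_lt _, by simp⟩

theorem exists_visits_of_load_pos {i : ZMod k} (h : 0 < load c i) : ∃ r, (i, r) ∈ c.support := by
  by_contra! hr
  simp [load, visits, hr] at h

theorem length_eq_of_cut_eq_zero [NeZero k] (hc : c.IsCycle) {z : ZMod k} {t : ℕ} (htk : t < k)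
    (hz : cut c z = 0) (ht : cut c (z + 1 + t) = 0) (hpos : 0 < load c (z + 1 + t)) :
    c.length = ∑ i ∈ Finset.range (t + 1), load c (z + 1 + (i : ℕ)) := by
  rw [length_eq_sum_range hc z]
  symm
  refine Finset.sum_subset (Finset.range_subset_range.2 htk) fun i hi hit => ?_
  by_contra hne
  obtain ⟨r, hr⟩ := exists_visits_of_load_pos hpos
  obtain ⟨s, hs⟩ := exists_visits_of_load_pos (Nat.pos_of_ne_zero hne)
  obtain ⟨j, hj, hij⟩ := mem_initial_beads hz ht hr ⟨t, le_rfl, rfl⟩ _ hs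
  simp only [Finset.mem_range] at hi hit
  have := natCast_inj_of_lt hi (by omega) (add_left_cancel hij)
  omega

theorem length_of_cut_eq_zero [NeZero k] (hc : c.IsCycle) {z : ZMod k} (hz : cut c z = 0) :
    c.length = 4 ∨ c.length % 3 = 2 := by
  have step : ∀ t < k, ∀ S,
      (S = 0 ∧ cut c (z + t) = 0 ∨ S % 3 = 2 ∧ cut c (z + t) = 2) →
      S = ∑ i ∈ Finset.range t, load c (z + 1 + (i : ℕ)) →
      S + load c (z + 1 + t) = 0 ∧ cut c (z + 1 + t) = 0 ∨
      (c.length = 4 ∨ c.length % 3 = 2) ∨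
      (S + load c (z + 1 + t)) % 3 = 2 ∧ cut c (z + 1 + t) = 2 := by
    intro t htk S h hS
    have hl := length_eq_of_cut_eq_zero hc htk hz
    rw [Finset.sum_range_succ, ← hS] at hl
    have hcases := load_cases hc (z + t)
    rw [add_right_comm] at hcases
    rcases hcases with h' | h' | h' | h' | h' | ⟨-, -, -, h0, h4, h24, h35⟩
    · omega
    · omega
    · omega
    · omega
    · omega
    · exact absurd h4 (not_visits_of_turn htk hz h0 h24 h35)
  have key : ∀ t < k, (∑ i ∈ Finset.range (t + 1), load c (z + 1 + (i : ℕ)) = 0 ∧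
        cut c (z + 1 + t) = 0) ∨ (c.length = 4 ∨ c.length % 3 = 2) ∨
      ((∑ i ∈ Finset.range (t + 1), load c (z + 1 + (i : ℕ))) % 3 = 2 ∧ cut c (z + 1 + t) = 2) := by
    intro t htk
    induction t with
    | zero =>
      rw [Finset.sum_range_succ]
      exact step 0 htk _ (Or.inl ⟨by simp, by simpa using hz⟩) rfl
    | succ t ih =>
      rw [Finset.sum_range_succ]
      have e : z + ((t + 1 : ℕ) : ZMod k) = z + 1 + t := by push_cast; ring
      have := step (t + 1) htk
      rw [e] at this
      rcases ih (by omega) with h | h | h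
      · exact this _ (Or.inl h) rfl
      · exact Or.inr (Or.inl h)
      · exact this _ (Or.inr h) rfl
  have := key (k - 1) (Nat.sub_lt (NeZero.pos k) one_pos)
  have hk1 : 1 ≤ k := NeZero.pos k
  rw [Nat.sub_add_cancel hk1, ← length_eq_sum_range hc z, Nat.cast_sub hk1] at this
  have hlast : z + 1 + (((k : ℕ) : ZMod k) - ((1 : ℕ) : ZMod k)) = z := by simp
  rw [hlast] at this
  have := hc.three_le_length
  omega

theorem length_of_isCycle (hk : 2 ≤ k) (hc : c.IsCycle) : c.length = 4 ∨
    (∃ m : ℕ, 1 ≤ m ∧ m ≤ k - 1 ∧ c.length = 3 * m + 2) ∨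
    (3 * k ≤ c.length ∧ c.length ≤ 6 * k) := by
  have : NeZero k := ⟨by omega⟩
  have h3 := hc.three_le_length
  have hle : c.length ≤ 6 * k := by
    rw [length_eq_sum_load hc]
    have : ∀ i ∈ Finset.univ, load c i ≤ 6 := fun i _ =>
      (Finset.sum_le_card_nsmul _ _ 1 fun r _ => Bool.toNat_le _).trans (by simp)
    refine (Finset.sum_le_card_nsmul _ _ _ this).trans ?_
    simp [ZMod.card, mul_comm]
  by_cases hz : ∃ z, cut c z = 0
  · obtain ⟨z, hz⟩ := hz
    rcases length_of_cut_eq_zero hc hz with h | h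
    · exact Or.inl h
    · by_cases hlen : 3 * k ≤ c.length
      · exact Or.inr (Or.inr ⟨hlen, hle⟩)
      · exact Or.inr (Or.inl ⟨c.length / 3, by omega, by omega, by omega⟩)
  · push Not at hz
    refine Or.inr (Or.inr ⟨?_, hle⟩)
    rw [length_eq_sum_load hc]
    have : ∀ i ∈ Finset.univ, 3 ≤ load c i := fun i _ => by
      have h := load_cases hc (i - 1)
      rw [sub_add_cancel] at h
      have h1 := hz i
      have h2 := hz (i - 1)
      omega
    refine le_trans ?_ (Finset.card_nsmul_le_sum _ _ _ this)
    simp [ZMod.card, mul_comm]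

end cycle

end Necklace

theorem SimpleGraph.HamiltonianConnected.of_iso {V W : Type*} {G : SimpleGraph V}
    {H : SimpleGraph W} (e : G ≃g H) (h : G.HamiltonianConnected) : H.HamiltonianConnected := by
  intro u v huv
  obtain ⟨p, hp, hs⟩ := h (e.symm u) (e.symm v) (e.symm.injective.ne huv)
  refine ⟨(p.map e.toHom).copy (by simp) (by simp), ?_, fun w => ?_⟩
  · rw [SimpleGraph.Walk.isPath_copy]
    exact hp.map e.injective
  · simpa using ⟨e.symm w, hs _, by simp⟩

theorem SimpleGraph.exists_cycle_of_iso {V W : Type*} {G : SimpleGraph V} {H : SimpleGraph W}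
    (e : G ≃g H) {l : ℕ} (h : ∃ (u : V) (c : G.Walk u u), c.IsCycle ∧ c.length = l) :
    ∃ (u : W) (c : H.Walk u u), c.IsCycle ∧ c.length = l := by
  obtain ⟨u, c, hc, hl⟩ := h
  exact ⟨e u, c.map e.toHom, hc.map e.injective, by simpa using hl⟩

/-- For each `k ≥ 2` there is a cubic hamiltonian-connected graph on `6k` vertices
whose cycle spectrum is exactly `{4} ∪ {3m+2 : 1 ≤ m ≤ k-1} ∪ [3k, 6k]`. -/
theorem exists_cubic_hamConnected_with_porous_cycle_spectrum (k : ℕ) (hk : 2 ≤ k) :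
    ∃ G : SimpleGraph (Fin (6 * k)),
      (∀ v, (G.neighborSet v).ncard = 3) ∧
      G.HamiltonianConnected ∧
      ∀ ℓ : ℕ,
        (∃ (u : Fin (6 * k)) (c : G.Walk u u), c.IsCycle ∧ c.length = ℓ) ↔
        (ℓ = 4 ∨ (∃ m : ℕ, 1 ≤ m ∧ m ≤ k - 1 ∧ ℓ = 3 * m + 2) ∨
          (3 * k ≤ ℓ ∧ ℓ ≤ 6 * k)) := by
  have : NeZero k := ⟨by omega⟩
  let e : Fin (6 * k) ≃ ZMod k × Fin 6 :=
    (Fintype.equivFinOfCardEq (by simp [ZMod.card, mul_comm])).symm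
  let φ : (Necklace.graph k).comap e ≃g Necklace.graph k := SimpleGraph.Iso.comap e _
  refine ⟨(Necklace.graph k).comap e, fun v => ?_,
    (Necklace.hamiltonianConnected hk).of_iso φ.symm, fun l => ⟨fun h => ?_, fun h => ?_⟩⟩
  · rw [← Necklace.ncard_neighborSet (e v)]
    exact Set.ncard_congr' (φ.mapNeighborSet v)
  · obtain ⟨u, c, hc, rfl⟩ := SimpleGraph.exists_cycle_of_iso φ h
    exact Necklace.length_of_isCycle hk hc
  · exact SimpleGraph.exists_cycle_of_iso φ.symm (Necklace.exists_cycle hk h)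
end

section
/- Let ℓ ≥ 3 be an integer and let G be a simple graph satisfying property P_ℓ. Then every edge of G is contained in a cycle of length ℓ. -/
/-- Property `P k`: between any two distinct vertices there is a path with exactly
`k` vertices, i.e. of length `k - 1`. -/
def SimpleGraph.HasPropP {V : Type*} (G : SimpleGraph V) (k : ℕ) : Prop :=
  ∀ u v : V, u ≠ v → ∃ p : G.Walk u v, p.IsPath ∧ p.length + 1 = k

/-- If `G` has property `P ℓ` with `ℓ ≥ 3`, then every edge of `G` lies in a cycle
of length `ℓ`. -/
theorem every_edge_in_cycle_of_propP
    {V : Type*} (G : SimpleGraph V) (ℓ : ℕ) (hℓ : 3 ≤ ℓ) (hG : G.HasPropP ℓ) :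
    ∀ e ∈ G.edgeSet, ∃ (w : V) (c : G.Walk w w), c.IsCycle ∧ c.length = ℓ ∧
      e ∈ c.edges := by
  intro e he
  induction e using Sym2.ind with
  | _ u v =>
    have hadj : G.Adj u v := he
    obtain ⟨p, hp, hlen⟩ := hG v u hadj.ne'
    refine ⟨u, SimpleGraph.Walk.cons hadj p, ?_, hlen, by simp⟩
    refine (SimpleGraph.Walk.cons_isCycle_iff p hadj).mpr ⟨hp, fun hmem => ?_⟩
    have := hp.length_eq_one_of_mem_edges (Sym2.eq_swap ▸ hmem)
    omega
end
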